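/- Let q>1 and let p∈[0,1] be such that p≠1 and θ¹(p,q)>0. Then for any two distinct open equivalence relations ∼ and ∼' on the set R of rays of T'_m, the measures φ^{1,∼}_{p,q} and φ^{1,∼'}_{p,q} are distinct. -/

import Mathlib

namespace RCTree

abbrev Edge (m : ℕ) := Fin (m + 1) × List (Fin m)
abbrev V (m : ℕ) := Option (Edge m)
abbrev Ray (m : ℕ) := Fin (m + 1) × (ℕ → Fin m)
abbrev Config (m : ℕ) := Edge m → Bool

variable {m : ℕ}

/-- The vertex at the top (towards the root) of an edge. -/
def parentV (e : Edge m) : V m :=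
  if e.2 = [] then none else some (e.1, e.2.dropLast)

/-- The vertex at the bottom (away from the root) of an edge. -/
def childV (e : Edge m) : V m := some e

/-- The (undirected) edge `e` has endvertices `u` and `v`. -/
def EndsAt (e : Edge m) (u v : V m) : Prop :=
  (parentV e = u ∧ childV e = v) ∨ (parentV e = v ∧ childV e = u)

/-- The `n`-th edge of a ray from the root. -/
def rayEdge (ρ : Ray m) (n : ℕ) : Edge m := (ρ.1, List.ofFn fun k : Fin n => ρ.2 k)

/-- The `n`-th vertex of a ray from the root. -/
def rayVtx (ρ : Ray m) : ℕ → V m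
  | 0 => none
  | n + 1 => some (rayEdge ρ n)

def rayEdges (ρ : Ray m) : Set (Edge m) := Set.range (rayEdge ρ)

/-- The ray `ρ` passes through the vertex `v`. -/
def RayThrough (ρ : Ray m) (v : V m) : Prop := ∃ n, rayVtx ρ n = v

/-- All edges of the ray `ρ` are open in `ω`. -/
def OpenRay (ω : Config m) (ρ : Ray m) : Prop := ∀ n, ω (rayEdge ρ n) = true

/-- An infinite self-avoiding (undirected) path with endpoint `x`. -/
structure IPath (m : ℕ) (x : V m) where
  vtx : ℕ → V m
  start : vtx 0 = x
  inj : Function.Injective vtx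
  adj : ∀ n, ∃ e : Edge m, EndsAt e (vtx n) (vtx (n + 1))

/-- The edges traversed by an infinite path. -/
def IPath.edges {x : V m} (π : IPath m x) : Set (Edge m) :=
  {e | ∃ n, EndsAt e (π.vtx n) (π.vtx (n + 1))}

/-- A path is forward (an `x`-ray) if it is directed away from the root. -/
def IPath.Forward {x : V m} (π : IPath m x) : Prop :=
  ∀ n, ∃ e : Edge m, parentV e = π.vtx n ∧ childV e = π.vtx (n + 1)

/-- All edges of the path `π` are open in `ω`. -/
def OpenPath {x : V m} (ω : Config m) (π : IPath m x) : Prop :=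
  ∀ e ∈ π.edges, ω e = true

/-- The path `π` and the `0`-ray `ρ` differ in only finitely many edges:
`ρ` is the `0`-ray associated with `π`. -/
def Assoc {x : V m} (π : IPath m x) (ρ : Ray m) : Prop :=
  ((IPath.edges π \ rayEdges ρ) ∪ (rayEdges ρ \ IPath.edges π)).Finite

/-- The set of edges with both endvertices in `Λ`. -/
def ELam (Λ : Set (V m)) : Set (Edge m) :=
  {e | parentV e ∈ Λ ∧ childV e ∈ Λ}

/-- The event `K^S_{u,v,Λ}`: there exist vertex-disjoint open infinite paths from `u` and
from `v`, edge-disjoint from `E_Λ`, whose associated `0`-rays are `S`-related. -/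
def KEvent (S : Ray m → Ray m → Prop) (Λ : Set (V m)) (u v : V m) : Set (Config m) :=
  {ω | ∃ (πu : IPath m u) (πv : IPath m v),
      (∀ a b, πu.vtx a ≠ πv.vtx b) ∧
      OpenPath ω πu ∧ OpenPath ω πv ∧
      (∀ e ∈ πu.edges, e ∉ ELam Λ) ∧ (∀ e ∈ πv.edges, e ∉ ELam Λ) ∧
      ∃ ρu ρv : Ray m, Assoc πu ρu ∧ Assoc πv ρv ∧ S ρu ρv}

/-- The event `A^S_{u,v}`: there exist open `u`- and `v`-rays whose associated
`0`-rays are `S`-related. -/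
def AEvent (S : Ray m → Ray m → Prop) (u v : V m) : Set (Config m) :=
  {ω | ∃ (πu : IPath m u) (πv : IPath m v),
      πu.Forward ∧ πv.Forward ∧ OpenPath ω πu ∧ OpenPath ω πv ∧
      ∃ ρu ρv : Ray m, Assoc πu ρu ∧ Assoc πv ρv ∧ S ρu ρv}

/-- The event `A'^S_{u,v}`: there exist open `0`-rays through `u` and through `v`
that are `S`-related. -/
def APrimeEvent (S : Ray m → Ray m → Prop) (u v : V m) : Set (Config m) :=
  {ω | ∃ ρu ρv : Ray m, RayThrough ρu u ∧ RayThrough ρv v ∧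
      OpenRay ω ρu ∧ OpenRay ω ρv ∧ S ρu ρv}

/-- `u` lies on the (unique) path of the tree from the root to `v` (ancestor-or-equal). -/
def Anc : V m → V m → Prop
  | none, _ => True
  | some _, none => False
  | some e, some f => e.1 = f.1 ∧ e.2 <+: f.2

/-- Two vertices are comparable if one lies on the path from the root to the other. -/
def Comparable (u v : V m) : Prop := Anc u v ∨ Anc v u

/-- `W` is a cutset: it is incomparable (no ray contains more than one member of `W`)
and every ray contains some member of `W`. -/
def IsCutset (W : Set (V m)) : Prop :=
  (∀ (ρ : Ray m) (u v : V m), u ∈ W → v ∈ W → RayThrough ρ u → RayThrough ρ v → u = v) ∧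
  ∀ ρ : Ray m, ∃ v ∈ W, RayThrough ρ v

noncomputable section
open scoped ENNReal
open Classical MeasureTheory

variable {m : ℕ}

/-- The finite set of edges with both endvertices in the finite vertex set `Λ`. -/
def EdgeFinset (Λ : Finset (V m)) : Finset (Edge m) :=
  (Λ.preimage (childV) (Option.some_injective _).injOn).filter fun e => parentV e ∈ Λ

/-- The set `Ω^ξ_Λ` of configurations agreeing with `ξ` off `E_Λ`. -/
def cylinderSet (Λ : Finset (V m)) (ξ : Config m) : Set (Config m) :=
  {ω | ∀ e, e ∉ ELam (↑Λ : Set (V m)) → ω e = ξ e}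

/-- `u` and `v` are joined by an `ω`-open path using no edge of `E_Λ`. -/
def OutConn (Λ : Set (V m)) (ω : Config m) (u v : V m) : Prop :=
  ∃ (n : ℕ) (f : ℕ → V m), f 0 = u ∧ f n = v ∧
    ∀ i < n, ∃ e : Edge m, ω e = true ∧ e ∉ ELam Λ ∧ EndsAt e (f i) (f (i + 1))

/-- The adjacency used to count clusters: open edges of `E_Λ` together with the
augmentation rules (a) and (b). -/
def augRel (S : Ray m → Ray m → Prop) (Λ : Finset (V m)) (ω : Config m) (u v : V m) : Prop :=
  (∃ e ∈ ELam (↑Λ : Set (V m)), ω e = true ∧ EndsAt e u v) ∨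
    OutConn (↑Λ : Set (V m)) ω u v ∨ ω ∈ KEvent S (↑Λ : Set (V m)) u v

/-- The number `k^{ξ,∼}(Λ,ω)` of connected components of the augmented open graph on `Λ`
(for `ω` agreeing with `ξ` off `E_Λ`, the boundary condition is read off from `ω` itself). -/
def kCount (S : Ray m → Ray m → Prop) (Λ : Finset (V m)) (ω : Config m) : ℕ :=
  Nat.card (SimpleGraph.fromRel fun u v : {x // x ∈ Λ} => augRel S Λ ω ↑u ↑v).ConnectedComponent

/-- The random-cluster weight of a configuration. -/
def rcWeight (S : Ray m → Ray m → Prop) (p q : ℝ) (Λ : Finset (V m)) (ω : Config m) : ℝ≥0∞ :=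
  (∏ e ∈ EdgeFinset Λ, ENNReal.ofReal (if ω e then p else 1 - p)) *
    ENNReal.ofReal q ^ kCount S Λ ω

/-- The unnormalised random-cluster measure on `Λ` with boundary condition `ξ`. -/
def rcUnnorm (S : Ray m → Ray m → Prop) (p q : ℝ) (Λ : Finset (V m)) (ξ : Config m) :
    Measure (Config m) :=
  Measure.sum fun ω : {ω : Config m // ω ∈ cylinderSet Λ ξ} =>
    rcWeight S p q Λ (ω : Config m) • Measure.dirac (ω : Config m)

/-- The finite-volume random-cluster measure `φ^{ξ,∼}_{Λ,p,q}`. -/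
def rcFin (S : Ray m → Ray m → Prop) (p q : ℝ) (Λ : Finset (V m)) (ξ : Config m) :
    Measure (Config m) :=
  (rcUnnorm S p q Λ ξ Set.univ)⁻¹ • rcUnnorm S p q Λ ξ

/-- The σ-field `T_Λ` generated by the states of edges not in `E_Λ`. -/
def outSigma (Λ : Finset (V m)) : MeasurableSpace (Config m) :=
  MeasurableSpace.comap (fun ω (e : {e : Edge m // e ∉ EdgeFinset Λ}) => ω ↑e) inferInstance

/-- The set `R^∼_{p,q}` of `(∼)`random-cluster measures: probability measures whose
conditional measure given `T_Λ` at `ξ` is `φ^{ξ,∼}_{Λ,p,q}`, for every finite `Λ`. -/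
def RCSet (S : Ray m → Ray m → Prop) (p q : ℝ) : Set (Measure (Config m)) :=
  {φ | IsProbabilityMeasure φ ∧
    ∀ (Λ : Finset (V m)) (A : Set (Config m)), MeasurableSet A →
      ∀ B : Set (Config m), MeasurableSet[outSigma Λ] B →
        φ (A ∩ B) = ∫⁻ ξ in B, rcFin S p q Λ ξ A ∂φ}

/-- Weak convergence of the finite-volume measures as `Λ ↑ V`. -/
def WeakLim (μs : Finset (V m) → Measure (Config m)) (φ : Measure (Config m)) : Prop :=
  ∀ f : BoundedContinuousFunction (Config m) ℝ,
    Filter.Tendsto (fun Λ => ∫ ω, f ω ∂(μs Λ)) Filter.atTop (nhds (∫ ω, f ω ∂φ))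

/-- `μ` is the Bernoulli product measure with density `r` on the edges. -/
def IsBernoulliProduct (r : ℝ) (μ : Measure (Config m)) : Prop :=
  IsProbabilityMeasure μ ∧
    ∀ (s : Finset (Edge m)) (σ : Config m),
      μ {ω | ∀ e ∈ s, ω e = σ e} = ∏ e ∈ s, ENNReal.ofReal (if σ e then r else 1 - r)

/-- An increasing event. -/
def IncreasingEvent (A : Set (Config m)) : Prop :=
  ∀ ω ω' : Config m, (∀ e, ω e = true → ω' e = true) → ω ∈ A → ω' ∈ A

/-- Stochastic ordering of measures on the configuration space. -/
def StochLE (μ ν : Measure (Config m)) : Prop :=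
  ∀ A : Set (Config m), MeasurableSet A → IncreasingEvent A → μ A ≤ ν A

/-- The wired equivalence relation: all rays are equivalent. -/
def wiredRel (m : ℕ) : Ray m → Ray m → Prop := fun _ _ => True

/-- The all-open boundary configuration. -/
def oneCfg (m : ℕ) : Config m := fun _ => true

/-- `S`, viewed as a subset of `R × R`, is closed. -/
def IsClosedRel (S : Ray m → Ray m → Prop) : Prop :=
  IsClosed {x : Ray m × Ray m | S x.1 x.2}

/-- The closure of the relation `S`: the intersection of all closed equivalence
relations containing `S`. -/
def closureRel (S : Ray m → Ray m → Prop) : Ray m → Ray m → Prop := fun a b =>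
  ∀ T : Ray m → Ray m → Prop, Equivalence T → IsClosedRel T → (∀ x y, S x y → T x y) → T a b

end

open MeasureTheory Filter
open scoped ENNReal

section Tree
variable {m : ℕ}

/-- The distance of a vertex from the root. -/
def depth : V m → ℕ
  | none => 0
  | some e => e.2.length + 1

theorem depth_rayVtx (ρ : Ray m) (k : ℕ) : depth (rayVtx ρ k) = k := by
  cases k <;> simp [rayVtx, depth, rayEdge]

theorem childV_rayEdge (ρ : Ray m) (k : ℕ) : childV (rayEdge ρ k) = rayVtx ρ (k + 1) := rfl

theorem parentV_rayEdge (ρ : Ray m) (k : ℕ) : parentV (rayEdge ρ k) = rayVtx ρ k := by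
  cases k with
  | zero => simp [rayVtx, parentV, rayEdge]
  | succ k =>
    have h : (rayEdge ρ (k + 1)).2 = (rayEdge ρ k).2 ++ [ρ.2 k] := by
      simp only [rayEdge, List.ofFn_succ', List.concat_eq_append]
      rfl
    rw [parentV, if_neg (by simp [h]), h, List.dropLast_concat]
    rfl

theorem rayVtx_succ_eq_iff (ρ ρ' : Ray m) (k : ℕ) :
    rayVtx ρ (k + 1) = rayVtx ρ' (k + 1) ↔ ρ.1 = ρ'.1 ∧ ∀ j < k, ρ.2 j = ρ'.2 j := by
  simp only [rayVtx, rayEdge, Option.some.injEq, Prod.mk.injEq, List.ofFn_inj, funext_iff]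
  exact and_congr_right fun _ => ⟨fun h j hj => h ⟨j, hj⟩, fun h j => h j j.2⟩

theorem rayVtx_eq_of_le {ρ ρ' : Ray m} {j k : ℕ} (h : rayVtx ρ k = rayVtx ρ' k) (hjk : j ≤ k) :
    rayVtx ρ j = rayVtx ρ' j := by
  cases j with
  | zero => rfl
  | succ j =>
    cases k with
    | zero => omega
    | succ k =>
      rw [rayVtx_succ_eq_iff] at h ⊢
      exact ⟨h.1, fun i hi => h.2 i (by omega)⟩

theorem rayVtx_inj {ρ ρ' : Ray m} {j k : ℕ} (h : rayVtx ρ j = rayVtx ρ' k) : j = k := by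
  simpa [depth_rayVtx] using congrArg depth h

theorem rayEdge_inj {ρ ρ' : Ray m} {j k : ℕ} (h : rayEdge ρ j = rayEdge ρ' k) : j = k := by
  have : rayVtx ρ (j + 1) = rayVtx ρ' (k + 1) := by simp [rayVtx, h]
  have := rayVtx_inj this
  omega

theorem exists_rayEdge (i : Fin m) (e : Edge m) : ∃ (ρ : Ray m) (k : ℕ), e = rayEdge ρ k := by
  refine ⟨(e.1, fun k => e.2.getD k i), e.2.length, Prod.ext rfl ?_⟩
  apply List.ext_getElem <;> simp +contextual [rayEdge]

theorem exists_rayVtx (ρ₀ : Ray m) (x : V m) : ∃ (ρ : Ray m) (k : ℕ), x = rayVtx ρ k := by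
  cases x with
  | none => exact ⟨ρ₀, 0, rfl⟩
  | some e =>
    obtain ⟨ρ, k, h⟩ := exists_rayEdge (ρ₀.2 0) e
    exact ⟨ρ, k + 1, by simp [rayVtx, h]⟩

/-- `x` is a descendant of `u` (or equal to it). -/
def Below (u x : V m) : Prop := ∃ (ρ : Ray m) (j k : ℕ), j ≤ k ∧ u = rayVtx ρ j ∧ x = rayVtx ρ k

theorem Below.refl (ρ₀ : Ray m) (u : V m) : Below u u := by
  obtain ⟨ρ, k, h⟩ := exists_rayVtx ρ₀ u
  exact ⟨ρ, k, k, le_rfl, h, h⟩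

theorem Below.eq_rayVtx {u : V m} {ρ : Ray m} {k : ℕ} (h : Below u (rayVtx ρ k)) :
    u = rayVtx ρ (depth u) := by
  obtain ⟨ρ', j, k', hj, rfl, hx⟩ := h
  obtain rfl := rayVtx_inj hx
  rw [depth_rayVtx]
  exact (rayVtx_eq_of_le hx hj).symm

theorem Below.depth_le {u x : V m} (h : Below u x) : depth u ≤ depth x := by
  obtain ⟨ρ', j, k', hj, rfl, rfl⟩ := h
  simpa [depth_rayVtx]

theorem Below.antisymm {u x : V m} (h : Below u x) (h' : Below x u) : u = x := by
  have := h'.depth_le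
  obtain ⟨ρ', j, k', hj, rfl, rfl⟩ := h
  rw [depth_rayVtx, depth_rayVtx] at this
  rw [le_antisymm hj this]

/-- The ball of radius `n` about the root. -/
noncomputable def ball (m n : ℕ) : Finset (V m) :=
  Set.Finite.toFinset (s := {x : V m | depth x ≤ n}) <| by
    have h : {e : Edge m | e.2.length ≤ n}.Finite := by
      have := (Set.finite_univ (α := Fin (m + 1))).prod (List.finite_length_le (Fin m) n)
      refine this.subset fun e he => ⟨trivial, he⟩
    refine ((h.image some).insert none).subset ?_
    rintro (_ | e) he
    · exact Set.mem_insert _ _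
    · exact Set.mem_insert_of_mem _ ⟨e, by simp [depth] at he ⊢; omega, rfl⟩

theorem mem_ball {n : ℕ} {x : V m} : x ∈ ball m n ↔ depth x ≤ n := by simp [ball]

theorem rayVtx_mem_ball {ρ : Ray m} {n k : ℕ} : rayVtx ρ k ∈ ball m n ↔ k ≤ n := by
  rw [mem_ball, depth_rayVtx]

theorem rayEdge_mem_ELam_ball {ρ : Ray m} {n k : ℕ} :
    rayEdge ρ k ∈ ELam (↑(ball m n) : Set (V m)) ↔ k < n := by
  simp only [ELam, Set.mem_ofPred_eq, Finset.mem_coe, parentV_rayEdge, childV_rayEdge,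
    rayVtx_mem_ball]
  omega

theorem mem_EdgeFinset {Λ : Finset (V m)} {e : Edge m} :
    e ∈ EdgeFinset Λ ↔ e ∈ ELam (↑Λ : Set (V m)) := by
  rw [EdgeFinset, Finset.mem_filter]
  exact (and_congr_left fun _ => Finset.mem_preimage).trans and_comm

theorem tendsto_ball : Tendsto (ball m) atTop atTop := by
  refine tendsto_atTop_finset_of_monotone ?_ ?_
  · intro a b hab x
    simp only [mem_ball]
    omega
  · exact fun x => ⟨depth x, mem_ball.2 le_rfl⟩

/-- A walk step outside the ball cannot leave the set of descendants of a vertex in the ball. -/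
theorem Below.step {n : ℕ} {u x y : V m} (ρ₀ : Ray m) (hu : u ∈ ball m n) (hx : Below u x)
    {e : Edge m} (he : e ∉ ELam (↑(ball m n) : Set (V m))) (hxy : EndsAt e x y) : Below u y := by
  obtain ⟨ρ, k, rfl⟩ := exists_rayEdge (ρ₀.2 0) e
  simp only [EndsAt, parentV_rayEdge, childV_rayEdge] at hxy
  rw [rayEdge_mem_ELam_ball] at he
  rcases hxy with ⟨rfl, rfl⟩ | ⟨rfl, rfl⟩
  · have hd := hx.depth_le
    rw [depth_rayVtx] at hd
    exact ⟨ρ, _, _, by omega, hx.eq_rayVtx, rfl⟩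
  · have hd := hx.depth_le
    have hu' := mem_ball.1 hu
    refine ⟨ρ, depth u, k, ?_, hx.eq_rayVtx, rfl⟩
    omega

theorem below_of_walk {n : ℕ} {u : V m} (ρ₀ : Ray m) (hu : u ∈ ball m n) (f : ℕ → V m)
    (h0 : f 0 = u) (N : ℕ)
    (hf : ∀ i < N, ∃ e : Edge m, e ∉ ELam (↑(ball m n) : Set (V m)) ∧ EndsAt e (f i) (f (i + 1))) :
    ∀ i ≤ N, Below u (f i) := by
  intro i hi
  induction i with
  | zero => rw [h0]; exact Below.refl ρ₀ u
  | succ i ih =>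
    obtain ⟨e, he, hxy⟩ := hf i hi
    exact (ih (by omega)).step ρ₀ hu he hxy

theorem EndsAt.symm {e : Edge m} {u v : V m} (h : EndsAt e u v) : EndsAt e v u := Or.symm h

theorem OutConn.symm {Λ : Set (V m)} {ω : Config m} {u v : V m} (h : OutConn Λ ω u v) :
    OutConn Λ ω v u := by
  obtain ⟨n, f, h0, hn, hf⟩ := h
  refine ⟨n, fun i => f (n - i), by simpa, by simpa, fun i hi => ?_⟩
  obtain ⟨e, he, he', hxy⟩ := hf (n - (i + 1)) (by omega)
  refine ⟨e, he, he', ?_⟩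
  have : n - (i + 1) + 1 = n - i := by omega
  rw [this] at hxy
  exact hxy.symm

theorem OutConn.eq {n : ℕ} {ω : Config m} {u v : V m} (ρ₀ : Ray m) (hu : u ∈ ball m n)
    (hv : v ∈ ball m n) (h : OutConn (↑(ball m n) : Set (V m)) ω u v) : u = v := by
  have key : ∀ {u v : V m}, u ∈ ball m n → OutConn (↑(ball m n) : Set (V m)) ω u v →
      Below u v := by
    rintro u v hu ⟨N, f, h0, hn, hf⟩
    rw [← hn]
    refine below_of_walk ρ₀ hu f h0 N (fun i hi => ?_) N le_rfl
    obtain ⟨e, _, he, hxy⟩ := hf i hi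
    exact ⟨e, he, hxy⟩
  exact (key hu h).antisymm (key hv h.symm)

theorem EndsAt.unique {e e' : Edge m} {u v : V m} (h : EndsAt e u v) (h' : EndsAt e' u v) :
    e = e' := by
  have hlt : ∀ e : Edge m, ∀ u v : V m, parentV e = u → childV e = v → depth v = depth u + 1 := by
    rintro ⟨a, l⟩ _ _ rfl rfl
    rcases l.eq_nil_or_concat with rfl | ⟨l', b, rfl⟩ <;> simp [parentV, childV, depth]
  rcases h with ⟨h1, h2⟩ | ⟨h1, h2⟩ <;> rcases h' with ⟨h3, h4⟩ | ⟨h3, h4⟩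
  · exact Option.some.inj (h2.trans h4.symm)
  · have := hlt _ _ _ h1 h2; have := hlt _ _ _ h3 h4; omega
  · have := hlt _ _ _ h1 h2; have := hlt _ _ _ h3 h4; omega
  · exact Option.some.inj (h2.trans h4.symm)

/-- An infinite path that avoids the edges of a ball starts on its boundary and its associated
`0`-ray passes through its starting point. -/
theorem IPath.eq_rayVtx {n : ℕ} {u : V m} (ρ₀ : Ray m) (hu : u ∈ ball m n) (π : IPath m u)
    (hπ : ∀ e ∈ π.edges, e ∉ ELam (↑(ball m n) : Set (V m))) {ρ : Ray m} (hρ : Assoc π ρ) :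
    u = rayVtx ρ n := by
  have hedge : ∀ i, ∃ e : Edge m, e ∉ ELam (↑(ball m n) : Set (V m)) ∧
      EndsAt e (π.vtx i) (π.vtx (i + 1)) := fun i => by
    obtain ⟨e, he⟩ := π.adj i
    exact ⟨e, hπ e ⟨i, he⟩, he⟩
  have hbelow : ∀ i, Below u (π.vtx i) := fun i =>
    below_of_walk ρ₀ hu π.vtx π.start i (fun j _ => hedge j) i le_rfl
  have hdepth : depth u = n := by
    apply le_antisymm (mem_ball.1 hu)
    obtain ⟨e, he, hxy⟩ := hedge 0
    obtain ⟨ρ', k, rfl⟩ := exists_rayEdge (ρ₀.2 0) e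
    rw [rayEdge_mem_ELam_ball] at he
    rw [π.start] at hxy
    simp only [EndsAt, parentV_rayEdge, childV_rayEdge] at hxy
    rcases hxy with ⟨h1, h2⟩ | ⟨h1, h2⟩ <;> rw [← ‹_ = u›, depth_rayVtx] <;> omega
  have hinf : (rayEdges ρ ∩ π.edges).Nonempty := by
    by_contra hne
    rw [Set.not_nonempty_iff_eq_empty] at hne
    have hfin : (rayEdges ρ).Finite := by
      refine hρ.subset fun e he => Or.inr ⟨he, fun he' => ?_⟩
      have : e ∈ rayEdges ρ ∩ π.edges := ⟨he, he'⟩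
      rw [hne] at this
      exact this
    exact Set.infinite_range_of_injective (fun a b h => rayEdge_inj h) hfin
  obtain ⟨_, ⟨k, rfl⟩, i, hi⟩ := hinf
  have : Below u (rayVtx ρ (k + 1)) := by
    rcases hi with ⟨h1, h2⟩ | ⟨h1, h2⟩ <;> rw [← childV_rayEdge, h2] <;> exact hbelow _
  rw [← hdepth]
  exact this.eq_rayVtx

/-- The tail of a ray from its `n`-th vertex on. -/
def rayTail (ρ : Ray m) (n : ℕ) : IPath m (rayVtx ρ n) where
  vtx k := rayVtx ρ (n + k)
  start := rfl
  inj a b h := by have := rayVtx_inj h; omega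
  adj k := ⟨rayEdge ρ (n + k), Or.inl ⟨parentV_rayEdge _ _, rfl⟩⟩

theorem mem_edges_rayTail {ρ : Ray m} {n : ℕ} {e : Edge m} :
    e ∈ (rayTail ρ n).edges ↔ ∃ k, e = rayEdge ρ (n + k) := by
  have h : ∀ k, EndsAt (rayEdge ρ (n + k)) ((rayTail ρ n).vtx k) ((rayTail ρ n).vtx (k + 1)) :=
    fun k => Or.inl ⟨parentV_rayEdge _ _, rfl⟩
  constructor
  · rintro ⟨k, hk⟩
    exact ⟨k, hk.unique (h k)⟩
  · rintro ⟨k, rfl⟩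
    exact ⟨k, h k⟩

theorem assoc_rayTail (ρ : Ray m) (n : ℕ) : Assoc (rayTail ρ n) ρ := by
  refine ((Set.finite_lt_nat n).image (rayEdge ρ)).subset ?_
  rintro e (⟨h1, h2⟩ | ⟨⟨k, rfl⟩, h2⟩)
  · obtain ⟨k, rfl⟩ := mem_edges_rayTail.1 h1
    exact (h2 ⟨_, rfl⟩).elim
  · refine ⟨k, ?_, rfl⟩
    by_contra hk
    refine h2 (mem_edges_rayTail.2 ⟨k - n, ?_⟩)
    simp only [Set.mem_ofPred_eq, not_lt] at hk
    rw [Nat.add_sub_cancel' hk]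

theorem mem_KEvent_ball_iff {S : Ray m → Ray m → Prop} {n : ℕ} {ω : Config m} {u v : V m}
    (hω : ω ∈ cylinderSet (ball m n) (oneCfg m)) (hu : u ∈ ball m n) (hv : v ∈ ball m n) :
    ω ∈ KEvent S (↑(ball m n) : Set (V m)) u v ↔
      u ≠ v ∧ ∃ ρ ρ' : Ray m, u = rayVtx ρ n ∧ v = rayVtx ρ' n ∧ S ρ ρ' := by
  constructor
  · rintro ⟨πu, πv, hdisj, _, _, hu', hv', ρ, ρ', h, h', hS⟩
    refine ⟨?_, ρ, ρ', πu.eq_rayVtx ρ hu hu' h, πv.eq_rayVtx ρ hv hv' h', hS⟩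
    have := hdisj 0 0
    rwa [πu.start, πv.start] at this
  · rintro ⟨hne, ρ, ρ', rfl, rfl, hS⟩
    have hout : ∀ ρ : Ray m, ∀ e ∈ (rayTail ρ n).edges, e ∉ ELam (↑(ball m n) : Set (V m)) := by
      intro ρ e he
      obtain ⟨k, rfl⟩ := mem_edges_rayTail.1 he
      rw [rayEdge_mem_ELam_ball]
      omega
    refine ⟨rayTail ρ n, rayTail ρ' n, fun a b hab => hne ?_, fun e he => hω e (hout _ e he),
      fun e he => hω e (hout _ e he), hout _, hout _, ρ, ρ', assoc_rayTail _ _,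
      assoc_rayTail _ _, hS⟩
    have := rayVtx_inj hab
    rw [show b = a by omega] at hab
    exact rayVtx_eq_of_le hab (by omega)

end Tree

section Weights
open Classical Module
variable {m : ℕ}

/-- The functions on vertices that are constant on open clusters and that eventually agree along
related rays. -/
def clusterSpace (S : Ray m → Ray m → Prop) (ω : Config m) : Submodule ℝ (V m → ℝ) where
  carrier := {f | (∀ e, ω e = true → f (parentV e) = f (childV e)) ∧
    ∀ ρ ρ', S ρ ρ' → ∀ᶠ k in atTop, f (rayVtx ρ k) = f (rayVtx ρ' k)}
  add_mem' := by
    rintro f g ⟨hf, hf'⟩ ⟨hg, hg'⟩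
    refine ⟨fun e he => congrArg₂ (· + ·) (hf e he) (hg e he), fun ρ ρ' h => ?_⟩
    filter_upwards [hf' ρ ρ' h, hg' ρ ρ' h] with k h1 h2
    exact congrArg₂ (· + ·) h1 h2
  zero_mem' := ⟨fun _ _ => rfl, fun _ _ _ => Eventually.of_forall fun _ => rfl⟩
  smul_mem' := by
    rintro c f ⟨hf, hf'⟩
    refine ⟨fun e he => congrArg (c * ·) (hf e he), fun ρ ρ' h => ?_⟩
    filter_upwards [hf' ρ ρ' h] with k h1
    exact congrArg (c * ·) h1

theorem rayVtx_const_of_open {S : Ray m → Ray m → Prop} {ω : Config m} {f : V m → ℝ}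
    (hf : f ∈ clusterSpace S ω) {ρ : Ray m} {j k : ℕ} (hjk : j ≤ k)
    (hopen : ∀ i, j ≤ i → i < k → ω (rayEdge ρ i) = true) :
    f (rayVtx ρ j) = f (rayVtx ρ k) := by
  induction k, hjk using Nat.le_induction with
  | base => rfl
  | succ k hk ih =>
    rw [ih fun i hi hik => hopen i hi (by omega), ← childV_rayEdge, ← parentV_rayEdge]
    exact hf.1 _ (hopen k hk (by omega))

/-- The configurations that are open off a ball. -/
noncomputable def cyl (m n : ℕ) : Finset (Config m) :=
  Set.Finite.toFinset (s := cylinderSet (ball m n) (oneCfg m)) <| by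
    refine Set.Finite.of_injOn (f := fun ω (e : {e // e ∈ EdgeFinset (ball m n)}) => ω e)
      (t := Set.univ) (fun _ _ => trivial) ?_ Set.finite_univ
    intro ω hω ω' hω' h
    funext e
    by_cases he : e ∈ EdgeFinset (ball m n)
    · exact congrFun h ⟨e, he⟩
    · rw [mem_EdgeFinset] at he
      rw [hω e he, hω' e he]

theorem mem_cyl' {n : ℕ} {ω : Config m} :
    ω ∈ cyl m n ↔ ω ∈ cylinderSet (ball m n) (oneCfg m) := by simp [cyl]

theorem mem_cyl {n : ℕ} {ω : Config m} :
    ω ∈ cyl m n ↔ ∀ e, e ∉ EdgeFinset (ball m n) → ω e = true := by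
  simp [mem_cyl', cylinderSet, mem_EdgeFinset, oneCfg]

theorem open_of_mem_cyl {n : ℕ} {ω : Config m} (h : ω ∈ cyl m n) {ρ : Ray m} {k : ℕ}
    (hk : n ≤ k) : ω (rayEdge ρ k) = true := by
  refine mem_cyl.1 h _ ?_
  rw [mem_EdgeFinset, rayEdge_mem_ELam_ball]
  omega

theorem rayVtx_const_of_mem_cyl {S : Ray m → Ray m → Prop} {ω : Config m} {f : V m → ℝ} {n : ℕ}
    (hω : ω ∈ cyl m n) (hf : f ∈ clusterSpace S ω) (ρ : Ray m) {k : ℕ} (hk : n ≤ k) :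
    f (rayVtx ρ n) = f (rayVtx ρ k) :=
  rayVtx_const_of_open hf hk fun _ hi _ => open_of_mem_cyl hω hi

theorem eq_of_related {S : Ray m → Ray m → Prop} {ω : Config m} {f : V m → ℝ} {n : ℕ}
    (hω : ω ∈ cyl m n) (hf : f ∈ clusterSpace S ω) {ρ ρ' : Ray m} (h : S ρ ρ') :
    f (rayVtx ρ n) = f (rayVtx ρ' n) := by
  obtain ⟨k, h1, h2⟩ := ((hf.2 ρ ρ' h).and (eventually_ge_atTop n)).exists
  rw [rayVtx_const_of_mem_cyl hω hf ρ h2, h1, rayVtx_const_of_mem_cyl hω hf ρ' h2]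

/-- The last vertex in the ball of radius `n` on the path from the root to a vertex. -/
noncomputable def trunc (ρ₀ : Ray m) (n : ℕ) (x : V m) : V m :=
  rayVtx (exists_rayVtx ρ₀ x).choose (min (depth x) n)

theorem trunc_rayVtx (ρ₀ : Ray m) (n : ℕ) (ρ : Ray m) (k : ℕ) :
    trunc ρ₀ n (rayVtx ρ k) = rayVtx ρ (min k n) := by
  obtain ⟨j, hj⟩ := (exists_rayVtx ρ₀ (rayVtx ρ k)).choose_spec
  obtain rfl := rayVtx_inj hj
  rw [trunc, depth_rayVtx]
  exact (rayVtx_eq_of_le hj (min_le_left _ _)).symm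

theorem trunc_mem_ball (ρ₀ : Ray m) (n : ℕ) (x : V m) : trunc ρ₀ n x ∈ ball m n := by
  rw [trunc, rayVtx_mem_ball]
  exact min_le_right _ _

theorem trunc_of_mem_ball (ρ₀ : Ray m) {n : ℕ} {x : V m} (hx : x ∈ ball m n) :
    trunc ρ₀ n x = x := by
  obtain ⟨ρ, k, rfl⟩ := exists_rayVtx ρ₀ x
  rw [trunc_rayVtx, min_eq_left (rayVtx_mem_ball.1 hx)]

theorem kCount_eq_finrank (ρ₀ : Ray m) (S : Ray m → Ray m → Prop) {n : ℕ} {ω : Config m}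
    (hω : ω ∈ cyl m n) : kCount S (ball m n) ω = finrank ℝ (clusterSpace S ω) := by
  set G : SimpleGraph {x // x ∈ ball m n} :=
    SimpleGraph.fromRel fun u v => augRel S (ball m n) ω ↑u ↑v with hG
  let Φ : (G.ConnectedComponent → ℝ) →ₗ[ℝ] (V m → ℝ) :=
    LinearMap.funLeft ℝ ℝ fun x => G.connectedComponentMk ⟨trunc ρ₀ n x, trunc_mem_ball ρ₀ n x⟩
  have hinj : Function.Injective Φ := by
    refine LinearMap.funLeft_injective_of_surjective ℝ ℝ _ fun c => ?_
    induction c using SimpleGraph.ConnectedComponent.ind with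
    | h v => exact ⟨v, congrArg _ (Subtype.ext (trunc_of_mem_ball ρ₀ v.2))⟩
  have hmk : ∀ u v : {x // x ∈ ball m n}, augRel S (ball m n) ω ↑u ↑v →
      G.connectedComponentMk u = G.connectedComponentMk v := by
    intro u v h
    by_cases huv : u = v
    · rw [huv]
    · refine SimpleGraph.ConnectedComponent.sound (SimpleGraph.Adj.reachable ?_)
      rw [hG, SimpleGraph.fromRel_adj]
      exact ⟨huv, Or.inl h⟩
  have hrange : LinearMap.range Φ = clusterSpace S ω := by
    apply le_antisymm
    · rintro _ ⟨g, rfl⟩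
      refine ⟨fun e he => ?_, fun ρ ρ' h => ?_⟩
      · obtain ⟨ρ, k, rfl⟩ := exists_rayEdge (ρ₀.2 0) e
        simp only [Φ, LinearMap.funLeft_apply, parentV_rayEdge, childV_rayEdge, trunc_rayVtx]
        congr 1
        by_cases hk : k < n
        · refine hmk _ _ (Or.inl ⟨rayEdge ρ k, rayEdge_mem_ELam_ball.2 hk, he, Or.inl ?_⟩)
          simp only [parentV_rayEdge, childV_rayEdge, min_eq_left hk.le,
            min_eq_left (Nat.succ_le_of_lt hk), and_self]
        · congr 3
          omega
      · filter_upwards [eventually_ge_atTop n] with k hk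
        simp only [Φ, LinearMap.funLeft_apply, trunc_rayVtx, min_eq_right hk]
        congr 1
        by_cases huv : rayVtx ρ n = rayVtx ρ' n
        · congr 2
        · refine hmk _ _ (Or.inr (Or.inr ?_))
          rw [mem_KEvent_ball_iff (mem_cyl'.1 hω) (rayVtx_mem_ball.2 le_rfl)
            (rayVtx_mem_ball.2 le_rfl)]
          exact ⟨huv, ρ, ρ', rfl, rfl, h⟩
    · intro f hf
      have haug : ∀ u v : {x // x ∈ ball m n}, augRel S (ball m n) ω ↑u ↑v → f u = f v := by
        rintro u v (⟨e, _, he, ⟨h1, h2⟩ | ⟨h1, h2⟩⟩ | h | h)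
        · rw [← h1, ← h2, hf.1 e he]
        · rw [← h1, ← h2, hf.1 e he]
        · rw [h.eq ρ₀ u.2 v.2]
        · obtain ⟨_, ρ, ρ', h1, h2, h3⟩ :=
            (mem_KEvent_ball_iff (mem_cyl'.1 hω) u.2 v.2).1 h
          rw [h1, h2, eq_of_related hω hf h3]
      have hadj : ∀ u v : {x // x ∈ ball m n}, G.Adj u v → f u = f v := by
        intro u v h
        rw [hG, SimpleGraph.fromRel_adj] at h
        rcases h.2 with h | h
        · exact haug _ _ h
        · exact (haug _ _ h).symm
      refine ⟨SimpleGraph.ConnectedComponent.lift (fun v => f v) ?_, ?_⟩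
      · intro v w p _
        induction p with
        | nil => rfl
        | cons h _ ih => rw [hadj _ _ h, ih (by simp_all)]
      · funext x
        obtain ⟨ρ, k, rfl⟩ := exists_rayVtx ρ₀ x
        simp only [Φ, LinearMap.funLeft_apply, SimpleGraph.ConnectedComponent.lift_mk, trunc_rayVtx]
        rcases le_total k n with hk | hk
        · rw [min_eq_left hk]
        · rw [min_eq_right hk]
          exact rayVtx_const_of_mem_cyl hω hf ρ hk
  have := Fintype.ofFinite G.ConnectedComponent
  rw [← hrange, LinearMap.finrank_range_of_inj hinj, Module.finrank_fintype_fun_eq_card, kCount,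
    Nat.card_eq_fintype_card]

theorem finiteDimensional_clusterSpace (ρ₀ : Ray m) (S : Ray m → Ray m → Prop) {n : ℕ}
    {ω : Config m} (hω : ω ∈ cyl m n) : FiniteDimensional ℝ (clusterSpace S ω) := by
  let Φ : clusterSpace S ω →ₗ[ℝ] ({x // x ∈ ball m n} → ℝ) :=
    (LinearMap.funLeft ℝ ℝ Subtype.val).comp (clusterSpace S ω).subtype
  refine FiniteDimensional.of_injective Φ fun f g h => Subtype.ext (funext fun x => ?_)
  have h' : ∀ x ∈ ball m n, f.1 x = g.1 x := fun x hx => congrFun h ⟨x, hx⟩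
  obtain ⟨ρ, k, rfl⟩ := exists_rayVtx ρ₀ x
  rcases le_total k n with hk | hk
  · exact h' _ (rayVtx_mem_ball.2 hk)
  · rw [← rayVtx_const_of_mem_cyl hω f.2 ρ hk, ← rayVtx_const_of_mem_cyl hω g.2 ρ hk]
    exact h' _ (rayVtx_mem_ball.2 le_rfl)

/-- The real random-cluster weight on a ball with open boundary configuration. -/
noncomputable def wt (S : Ray m → Ray m → Prop) (p q : ℝ) (n : ℕ) (ω : Config m) : ℝ :=
  (∏ e ∈ EdgeFinset (ball m n), if ω e = true then p else 1 - p) *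
    q ^ finrank ℝ (clusterSpace S ω)

/-- The configurations in an event that are open off a ball. -/
noncomputable def cylIn (n : ℕ) (A : Set (Config m)) : Finset (Config m) :=
  (cyl m n).filter fun ω => ω ∈ A

theorem mem_cylIn {n : ℕ} {A : Set (Config m)} {ω : Config m} :
    ω ∈ cylIn n A ↔ ω ∈ cyl m n ∧ ω ∈ A := by rw [cylIn, Finset.mem_filter]

/-- The total weight of the configurations in an event. -/
noncomputable def mass (S : Ray m → Ray m → Prop) (p q : ℝ) (n : ℕ) (A : Set (Config m)) : ℝ :=
  ∑ ω ∈ cylIn n A, wt S p q n ω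

theorem edge_factor_nonneg {p : ℝ} (hp0 : 0 ≤ p) (hp1 : p ≤ 1) (ω : Config m) (e : Edge m) :
    0 ≤ if ω e = true then p else 1 - p := by
  split_ifs <;> linarith

theorem wt_nonneg {S : Ray m → Ray m → Prop} {p q : ℝ} (hp0 : 0 ≤ p) (hp1 : p ≤ 1) (hq : 0 ≤ q)
    (n : ℕ) (ω : Config m) : 0 ≤ wt S p q n ω :=
  mul_nonneg (Finset.prod_nonneg fun e _ => edge_factor_nonneg hp0 hp1 ω e) (pow_nonneg hq _)

theorem mass_nonneg {S : Ray m → Ray m → Prop} {p q : ℝ} (hp0 : 0 ≤ p) (hp1 : p ≤ 1) (hq : 0 ≤ q)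
    (n : ℕ) (A : Set (Config m)) : 0 ≤ mass S p q n A :=
  Finset.sum_nonneg fun _ _ => wt_nonneg hp0 hp1 hq _ _

theorem rcUnnorm_apply (ρ₀ : Ray m) (S : Ray m → Ray m → Prop) {p q : ℝ} (hp0 : 0 ≤ p)
    (hp1 : p ≤ 1) (hq : 0 ≤ q) (n : ℕ) {A : Set (Config m)} (hA : MeasurableSet A) :
    rcUnnorm S p q (ball m n) (oneCfg m) A = ENNReal.ofReal (mass S p q n A) := by
  have hwt : ∀ ω ∈ cyl m n, rcWeight S p q (ball m n) ω = ENNReal.ofReal (wt S p q n ω) := by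
    intro ω hω
    rw [rcWeight, wt, ENNReal.ofReal_mul (Finset.prod_nonneg fun e _ => edge_factor_nonneg hp0 hp1 ω e),
      ENNReal.ofReal_prod_of_nonneg (fun e _ => edge_factor_nonneg hp0 hp1 ω e), ENNReal.ofReal_pow hq,
      kCount_eq_finrank ρ₀ S hω]
  rw [rcUnnorm, Measure.sum_apply _ hA, mass,
    ENNReal.ofReal_sum_of_nonneg fun ω _ => wt_nonneg hp0 hp1 hq n ω, cylIn,
    Finset.sum_filter]
  have := Finset.tsum_subtype (cyl m n) fun ω => (rcWeight S p q (ball m n) ω • Measure.dirac ω) A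
  calc _ = ∑' ω : {ω // ω ∈ cyl m n},
          (rcWeight S p q (ball m n) ω • Measure.dirac (ω : Config m)) A := by
        exact Equiv.tsum_eq (Equiv.subtypeEquivRight fun ω => mem_cyl'.symm)
          fun ω : {ω // ω ∈ cyl m n} =>
            (rcWeight S p q (ball m n) ω • Measure.dirac (ω : Config m)) A
    _ = _ := by
        rw [this]
        refine Finset.sum_congr rfl fun ω hω => ?_
        rw [Measure.smul_apply, Measure.dirac_apply' _ hA, hwt ω hω]
        by_cases h : ω ∈ A <;> simp [h]

theorem rcFin_real (ρ₀ : Ray m) (S : Ray m → Ray m → Prop) {p q : ℝ} (hp0 : 0 ≤ p)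
    (hp1 : p ≤ 1) (hq : 0 ≤ q) (n : ℕ) {A : Set (Config m)} (hA : MeasurableSet A) :
    (rcFin S p q (ball m n) (oneCfg m)).real A = mass S p q n A / mass S p q n Set.univ := by
  rw [rcFin, measureReal_def, Measure.smul_apply, rcUnnorm_apply ρ₀ S hp0 hp1 hq n hA,
    rcUnnorm_apply ρ₀ S hp0 hp1 hq n MeasurableSet.univ, smul_eq_mul, ENNReal.toReal_mul,
    ENNReal.toReal_inv, ENNReal.toReal_ofReal (mass_nonneg hp0 hp1 hq _ _),
    ENNReal.toReal_ofReal (mass_nonneg hp0 hp1 hq _ _)]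
  ring

/-- Weak limits of the random-cluster measures evaluated at clopen events. -/
theorem WeakLim.tendsto_mass (ρ₀ : Ray m) {S : Ray m → Ray m → Prop} {p q : ℝ} (hp0 : 0 ≤ p)
    (hp1 : p ≤ 1) (hq : 0 ≤ q) {ψ : Measure (Config m)}
    (hψ : WeakLim (fun Λ => rcFin S p q Λ (oneCfg m)) ψ) {A : Set (Config m)} (hA : IsClopen A) :
    Tendsto (fun n => mass S p q n A / mass S p q n Set.univ) atTop (nhds (ψ.real A)) := by
  let f := BoundedContinuousFunction.indicator A hA
  have hAm : MeasurableSet A := hA.isOpen.measurableSet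
  have h := (hψ f).comp (tendsto_ball (m := m))
  have hf : ∀ μ : Measure (Config m), ∫ ω, f ω ∂μ = μ.real A := fun μ => integral_indicator_one hAm
  simpa only [hf, Function.comp_def, rcFin_real ρ₀ S hp0 hp1 hq _ hAm] using h

end Weights

section Inequalities
open Classical Module
variable {m : ℕ}

theorem finrank_le_add_card {E ι : Type*} [AddCommGroup E] [Module ℝ E] [Fintype ι]
    (U U' : Submodule ℝ E) [FiniteDimensional ℝ U] [FiniteDimensional ℝ U'] (L : E →ₗ[ℝ] (ι → ℝ))
    (h : ∀ f ∈ U, L f = 0 → f ∈ U') : finrank ℝ U ≤ finrank ℝ U' + Fintype.card ι := by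
  have h1 := (L.domRestrict U).finrank_range_add_finrank_ker
  have h2 : finrank ℝ (LinearMap.range (L.domRestrict U)) ≤ Fintype.card ι := by
    simpa using Submodule.finrank_le (LinearMap.range (L.domRestrict U))
  have h3 : finrank ℝ (LinearMap.ker (L.domRestrict U)) ≤ finrank ℝ U' := by
    refine LinearMap.finrank_le_finrank_of_injective
      (f := ((U.subtype.comp (LinearMap.ker (L.domRestrict U)).subtype).codRestrict U' ?_)) ?_
    · rintro ⟨⟨f, hf⟩, hf'⟩
      exact h f hf hf'
    · intro a b hab
      have hval := congrArg (fun x : U' => (x : E)) hab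
      exact Subtype.ext (Subtype.ext hval)
  omega

theorem inf_mem_cyl {n : ℕ} {ω ω' : Config m} (h : ω ∈ cyl m n) (h' : ω' ∈ cyl m n) :
    ω ⊓ ω' ∈ cyl m n :=
  mem_cyl.2 fun e he => by simp [mem_cyl.1 h e he, mem_cyl.1 h' e he]

theorem mem_cyl_of_le {n : ℕ} {ω ω' : Config m} (h : ω ∈ cyl m n)
    (hle : ∀ e, ω e = true → ω' e = true) : ω' ∈ cyl m n :=
  mem_cyl.2 fun e he => hle e (mem_cyl.1 h e he)

theorem wt_supermodular (ρ₀ : Ray m) (S : Ray m → Ray m → Prop) {p q : ℝ} (hp0 : 0 ≤ p)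
    (hp1 : p ≤ 1) (hq : 1 ≤ q) {n : ℕ} {ω ω' : Config m} (h : ω ∈ cyl m n) (h' : ω' ∈ cyl m n) :
    wt S p q n ω * wt S p q n ω' ≤ wt S p q n (ω ⊓ ω') * wt S p q n (ω ⊔ ω') := by
  have hsup : ω ⊔ ω' ∈ cyl m n := mem_cyl_of_le h fun e he => by simp [he]
  have := finiteDimensional_clusterSpace ρ₀ S h
  have := finiteDimensional_clusterSpace ρ₀ S h'
  have := finiteDimensional_clusterSpace ρ₀ S (inf_mem_cyl h h')
  have := finiteDimensional_clusterSpace ρ₀ S hsup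
  have hdim := Submodule.finrank_sup_add_finrank_inf_eq (clusterSpace S ω) (clusterSpace S ω')
  have h1 : finrank ℝ ↥(clusterSpace S ω ⊔ clusterSpace S ω') ≤
      finrank ℝ (clusterSpace S (ω ⊓ ω')) := by
    refine Submodule.finrank_mono (sup_le ?_ ?_)
    · exact fun f hf => ⟨fun e he => hf.1 e (by simp_all), hf.2⟩
    · exact fun f hf => ⟨fun e he => hf.1 e (by simp_all), hf.2⟩
  have h2 : finrank ℝ ↥(clusterSpace S ω ⊓ clusterSpace S ω') ≤
      finrank ℝ (clusterSpace S (ω ⊔ ω')) := by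
    refine Submodule.finrank_mono fun f hf => ⟨fun e he => ?_, hf.1.2⟩
    have : ω e = true ∨ ω' e = true := by simpa using he
    exact this.elim (hf.1.1 e) (hf.2.1 e)
  have hprod : (∏ e ∈ EdgeFinset (ball m n), if ω e = true then p else 1 - p) *
      (∏ e ∈ EdgeFinset (ball m n), if ω' e = true then p else 1 - p) =
      (∏ e ∈ EdgeFinset (ball m n), if (ω ⊓ ω') e = true then p else 1 - p) *
      (∏ e ∈ EdgeFinset (ball m n), if (ω ⊔ ω') e = true then p else 1 - p) := by
    rw [← Finset.prod_mul_distrib, ← Finset.prod_mul_distrib]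
    refine Finset.prod_congr rfl fun e _ => ?_
    cases h1 : ω e <;> cases h2 : ω' e <;> simp [h1, h2]
    ring
  unfold wt
  rw [mul_mul_mul_comm, mul_mul_mul_comm _ (q ^ _), hprod, ← pow_add, ← pow_add]
  refine mul_le_mul_of_nonneg_left (pow_le_pow_right₀ hq (by omega)) (mul_nonneg ?_ ?_) <;>
  exact Finset.prod_nonneg fun e _ => edge_factor_nonneg hp0 hp1 _ e

/-- The FKG inequality for the random-cluster weights. -/
theorem mass_fkg (ρ₀ : Ray m) (S : Ray m → Ray m → Prop) {p q : ℝ} (hp0 : 0 ≤ p)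
    (hp1 : p ≤ 1) (hq : 1 ≤ q) (n : ℕ) {A B : Set (Config m)} (hA : IncreasingEvent A)
    (hB : IncreasingEvent B) :
    mass S p q n A * mass S p q n B ≤ mass S p q n (A ∩ B) * mass S p q n Set.univ := by
  let f : Config m → ℝ := fun ω => if ω ∈ cyl m n then wt S p q n ω else 0
  have hf : 0 ≤ f := fun ω => by
    simp only [f]
    split_ifs
    · exact wt_nonneg hp0 hp1 (by linarith) n ω
    · exact le_rfl
  have hmass : ∀ A, mass S p q n A = ∑ ω ∈ cylIn n A, f ω := fun A => by
    refine Finset.sum_congr rfl fun ω hω => ?_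
    simp only [f, if_pos (mem_cylIn.1 hω).1]
  have hff : ∀ ω ω', f ω * f ω' ≤ f (ω ⊓ ω') * f (ω ⊔ ω') := by
    intro ω ω'
    by_cases h : ω ∈ cyl m n
    · by_cases h' : ω' ∈ cyl m n
      · have hsup : ω ⊔ ω' ∈ cyl m n := mem_cyl_of_le h fun e he => by simp [he]
        simp only [f, if_pos h, if_pos h', if_pos hsup, if_pos (inf_mem_cyl h h')]
        exact wt_supermodular ρ₀ S hp0 hp1 hq h h'
      · simp only [f, if_neg h', mul_zero]
        exact mul_nonneg (hf _) (hf _)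
    · simp only [f, if_neg h, zero_mul]
      exact mul_nonneg (hf _) (hf _)
  rw [mul_comm (mass S p q n (A ∩ B)), hmass, hmass, hmass, hmass]
  refine (four_functions_theorem f f f f hf hf hf hf hff _ _).trans ?_
  refine mul_le_mul ?_ ?_ (Finset.sum_nonneg fun _ _ => hf _) (Finset.sum_nonneg fun _ _ => hf _)
  · refine Finset.sum_le_sum_of_subset_of_nonneg ?_ fun _ _ _ => hf _
    rw [Finset.infs_subset_iff]
    intro a ha b hb
    rw [mem_cylIn] at ha hb ⊢
    exact ⟨inf_mem_cyl ha.1 hb.1, trivial⟩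
  · refine Finset.sum_le_sum_of_subset_of_nonneg ?_ fun _ _ _ => hf _
    rw [Finset.sups_subset_iff]
    intro a ha b hb
    rw [mem_cylIn] at ha hb ⊢
    exact ⟨mem_cyl_of_le ha.1 fun e he => by simp [he], hA a _ (fun e he => by simp [he]) ha.2,
      hB b _ (fun e he => by simp [he]) hb.2⟩

theorem EdgeFinset_ball_mono {n n' : ℕ} (h : n ≤ n') :
    EdgeFinset (ball m n) ⊆ EdgeFinset (ball m n') := by
  intro e he
  rw [mem_EdgeFinset] at he ⊢
  simp only [ELam, Set.mem_ofPred_eq, Finset.mem_coe, mem_ball] at he ⊢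
  omega

theorem mass_inter_cyl (S : Ray m → Ray m → Prop) (p q : ℝ) {n n' : ℕ} (h : n ≤ n') :
    ∃ k : ℕ, ∀ A : Set (Config m),
      mass S p q n' (A ∩ ↑(cyl m n)) = p ^ k * mass S p q n A := by
  refine ⟨(EdgeFinset (ball m n') \ EdgeFinset (ball m n)).card, fun A => ?_⟩
  unfold mass
  rw [Finset.mul_sum]
  refine Finset.sum_congr ?_ fun ω hω => ?_
  · ext ω
    simp only [mem_cylIn, Set.mem_inter_iff, Finset.mem_coe]
    refine ⟨fun h => ⟨h.2.2, h.2.1⟩, fun hω => ⟨?_, hω.2, hω.1⟩⟩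
    exact mem_cyl.2 fun e he => mem_cyl.1 hω.1 e fun he' => he (EdgeFinset_ball_mono h he')
  · rw [wt, wt, ← Finset.prod_sdiff (EdgeFinset_ball_mono h), mul_assoc]
    congr 1
    refine Finset.prod_eq_pow_card fun e he => ?_
    rw [if_pos (mem_cyl.1 (mem_cylIn.1 hω).1 e (Finset.mem_sdiff.1 he).2)]

theorem wt_pos {S : Ray m → Ray m → Prop} {p q : ℝ} (hp0 : 0 < p) (hp1 : p < 1) (hq : 0 < q)
    (n : ℕ) (ω : Config m) : 0 < wt S p q n ω := by
  refine mul_pos (Finset.prod_pos fun e _ => ?_) (pow_pos hq _)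
  split_ifs <;> linarith

theorem mass_univ_pos {S : Ray m → Ray m → Prop} {p q : ℝ} (hp0 : 0 < p) (hp1 : p < 1) (hq : 0 < q)
    (n : ℕ) : 0 < mass S p q n Set.univ := by
  refine Finset.sum_pos (fun ω _ => wt_pos hp0 hp1 hq n ω) ⟨oneCfg m, ?_⟩
  simp [mem_cylIn, mem_cyl, oneCfg]

/-- Some open path leads away from the root from the vertex `u` of depth `N` to depth `n`. -/
def reach (N : ℕ) (u : V m) (n : ℕ) : Set (Config m) :=
  {ω | ∃ ρ : Ray m, rayVtx ρ N = u ∧ ∀ k, N ≤ k → k < n → ω (rayEdge ρ k) = true}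

theorem increasingEvent_reach (N : ℕ) (u : V m) (n : ℕ) : IncreasingEvent (reach N u n) := by
  rintro ω ω' h ⟨ρ, hρ, hk⟩
  exact ⟨ρ, hρ, fun k h1 h2 => h _ (hk k h1 h2)⟩

theorem isClopen_of_local {A : Set (Config m)} (E : Finset (Edge m))
    (h : ∀ ω ω' : Config m, (∀ e ∈ E, ω e = ω' e) → ω ∈ A → ω' ∈ A) : IsClopen A := by
  let r : Config m → ({e // e ∈ E} → Bool) := fun ω e => ω e
  have hr : Continuous r := by fun_prop
  have hA : A = r ⁻¹' (r '' A) := by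
    refine Set.Subset.antisymm (Set.subset_preimage_image r A) ?_
    rintro ω ⟨ω', hω', h'⟩
    exact h ω' ω (fun e he => congrFun h' ⟨e, he⟩) hω'
  rw [hA]
  exact (isClopen_discrete _).preimage hr

theorem isClopen_reach (N : ℕ) (u : V m) (n : ℕ) : IsClopen (reach N u n) := by
  refine isClopen_of_local (EdgeFinset (ball m n)) ?_
  rintro ω ω' h ⟨ρ, hρ, hk⟩
  refine ⟨ρ, hρ, fun k h1 h2 => ?_⟩
  rw [← h _ (by rwa [mem_EdgeFinset, rayEdge_mem_ELam_ball])]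
  exact hk k h1 h2

/-- The probability that the root is connected to the boundary of a ball, under the measure on
this ball, is at least that of the infinite-volume limit. -/
theorem real_reach_mul_le_mass (ρ₀ : Ray m) {S : Ray m → Ray m → Prop} {p q : ℝ} (hp0 : 0 < p)
    (hp1 : p < 1) (hq : 1 ≤ q) {ψ : Measure (Config m)}
    (hψ : WeakLim (fun Λ => rcFin S p q Λ (oneCfg m)) ψ) (n : ℕ) :
    ψ.real (reach 0 none n) * mass S p q n Set.univ ≤ mass S p q n (reach 0 none n) := by
  have hpos : ∀ n, 0 < mass S p q n Set.univ := mass_univ_pos hp0 hp1 (by linarith)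
  rw [← le_div_iff₀ (hpos n)]
  refine le_of_tendsto (hψ.tendsto_mass ρ₀ hp0.le hp1.le (by linarith) (isClopen_reach 0 none n)) ?_
  filter_upwards [eventually_ge_atTop n] with n' hn'
  rw [div_le_div_iff₀ (hpos n') (hpos n)]
  have hD : IncreasingEvent (↑(cyl m n) : Set (Config m)) := fun ω ω' hle hω =>
    mem_cyl_of_le hω hle
  have hfkg := mass_fkg ρ₀ S hp0.le hp1.le hq n' (increasingEvent_reach 0 none n) hD
  obtain ⟨k, hk⟩ := mass_inter_cyl S p q hn'
  have huniv := hk Set.univ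
  rw [Set.univ_inter] at huniv
  rw [hk, huniv] at hfkg
  refine le_of_mul_le_mul_left ?_ (pow_pos hp0 k)
  linarith

end Inequalities

section Symmetry
open Classical Module
variable {m : ℕ}

/-- The level-wise transpositions exchanging the rays `a` and `b`, acting on rays. -/
def raySwap (a b ρ : Ray m) : Ray m :=
  (Equiv.swap a.1 b.1 ρ.1, fun k => Equiv.swap (a.2 k) (b.2 k) (ρ.2 k))

/-- The level-wise transpositions exchanging the rays `a` and `b`, acting on edges. -/
def edgeSwap (a b : Ray m) (e : Edge m) : Edge m :=
  (Equiv.swap a.1 b.1 e.1, e.2.mapIdx fun k => Equiv.swap (a.2 k) (b.2 k))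

/-- The level-wise transpositions exchanging the rays `a` and `b`, acting on vertices. -/
def vtxSwap (a b : Ray m) : V m → V m := Option.map (edgeSwap a b)

theorem raySwap_raySwap (a b ρ : Ray m) : raySwap a b (raySwap a b ρ) = ρ := by
  simp [raySwap]

theorem raySwap_left (a b : Ray m) : raySwap a b a = b := by
  simp [raySwap]

theorem edgeSwap_rayEdge (a b ρ : Ray m) (k : ℕ) :
    edgeSwap a b (rayEdge ρ k) = rayEdge (raySwap a b ρ) k := by
  refine Prod.ext rfl (List.ext_getElem ?_ ?_) <;> simp [edgeSwap, rayEdge, raySwap]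

theorem vtxSwap_rayVtx (a b ρ : Ray m) (k : ℕ) :
    vtxSwap a b (rayVtx ρ k) = rayVtx (raySwap a b ρ) k := by
  cases k with
  | zero => rfl
  | succ k => exact congrArg some (edgeSwap_rayEdge a b ρ k)

theorem edgeSwap_edgeSwap (a b : Ray m) (e : Edge m) : edgeSwap a b (edgeSwap a b e) = e := by
  obtain ⟨ρ, k, rfl⟩ := exists_rayEdge (a.2 0) e
  rw [edgeSwap_rayEdge, edgeSwap_rayEdge, raySwap_raySwap]

theorem edgeSwap_mem_EdgeFinset (a b : Ray m) {n : ℕ} {e : Edge m} :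
    edgeSwap a b e ∈ EdgeFinset (ball m n) ↔ e ∈ EdgeFinset (ball m n) := by
  obtain ⟨ρ, k, rfl⟩ := exists_rayEdge (a.2 0) e
  rw [edgeSwap_rayEdge, mem_EdgeFinset, mem_EdgeFinset, rayEdge_mem_ELam_ball,
    rayEdge_mem_ELam_ball]

theorem comp_edgeSwap_comp_edgeSwap (a b : Ray m) (ω : Config m) :
    (ω ∘ edgeSwap a b) ∘ edgeSwap a b = ω :=
  funext fun e => congrArg ω (edgeSwap_edgeSwap a b e)

theorem comp_edgeSwap_mem_cyl (a b : Ray m) {n : ℕ} {ω : Config m} (h : ω ∈ cyl m n) :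
    ω ∘ edgeSwap a b ∈ cyl m n :=
  mem_cyl.2 fun e he => mem_cyl.1 h _ (by rwa [edgeSwap_mem_EdgeFinset])

theorem finrank_comp_edgeSwap_le (a b : Ray m) {n : ℕ} {ω : Config m} (h : ω ∈ cyl m n) :
    finrank ℝ (clusterSpace (wiredRel m) ω) ≤
      finrank ℝ (clusterSpace (wiredRel m) (ω ∘ edgeSwap a b)) := by
  have := finiteDimensional_clusterSpace a (wiredRel m) (comp_edgeSwap_mem_cyl a b h)
  refine LinearMap.finrank_le_finrank_of_injective
    (f := ((LinearMap.funLeft ℝ ℝ (vtxSwap a b)).comp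
      (clusterSpace (wiredRel m) ω).subtype).codRestrict _ ?_) ?_
  · rintro ⟨f, hf⟩
    refine ⟨fun e he => ?_, fun ρ ρ' _ => ?_⟩
    · obtain ⟨ρ, k, rfl⟩ := exists_rayEdge (a.2 0) e
      rw [Function.comp_apply, edgeSwap_rayEdge] at he
      have := hf.1 _ he
      simpa [LinearMap.funLeft_apply, parentV_rayEdge, childV_rayEdge, vtxSwap_rayVtx] using this
    · filter_upwards [hf.2 (raySwap a b ρ) (raySwap a b ρ') trivial] with k hk
      simpa [LinearMap.funLeft_apply, vtxSwap_rayVtx] using hk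
  · rintro ⟨f, hf⟩ ⟨g, hg⟩ hfg
    refine Subtype.ext (funext fun x => ?_)
    obtain ⟨ρ, k, rfl⟩ := exists_rayVtx a x
    have := congrFun (congrArg Subtype.val hfg) (rayVtx (raySwap a b ρ) k)
    simpa [LinearMap.funLeft_apply, vtxSwap_rayVtx, raySwap_raySwap] using this

theorem wt_comp_edgeSwap (a b : Ray m) (p q : ℝ) {n : ℕ} {ω : Config m} (h : ω ∈ cyl m n) :
    wt (wiredRel m) p q n (ω ∘ edgeSwap a b) = wt (wiredRel m) p q n ω := by
  have hdim : finrank ℝ (clusterSpace (wiredRel m) (ω ∘ edgeSwap a b)) =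
      finrank ℝ (clusterSpace (wiredRel m) ω) := by
    refine le_antisymm ?_ (finrank_comp_edgeSwap_le a b h)
    have := finrank_comp_edgeSwap_le a b (comp_edgeSwap_mem_cyl a b h)
    rwa [comp_edgeSwap_comp_edgeSwap] at this
  rw [wt, wt, hdim]
  congr 1
  refine Finset.prod_nbij' (edgeSwap a b) (edgeSwap a b)
    (fun e he => (edgeSwap_mem_EdgeFinset a b).2 he)
    (fun e he => (edgeSwap_mem_EdgeFinset a b).2 he)
    (fun e _ => edgeSwap_edgeSwap a b e) (fun e _ => edgeSwap_edgeSwap a b e) fun e _ => rfl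

theorem mass_reach_le (a b : Ray m) {p q : ℝ} (hp0 : 0 ≤ p) (hp1 : p ≤ 1) (hq : 0 ≤ q) (N n : ℕ) :
    mass (wiredRel m) p q n (reach N (rayVtx a N) n) ≤
      mass (wiredRel m) p q n (reach N (rayVtx b N) n) := by
  unfold mass
  have hinj : Set.InjOn (fun ω : Config m => ω ∘ edgeSwap a b)
      ↑(cylIn n (reach N (rayVtx a N) n)) := fun ω _ ω' _ h => by
    rw [← comp_edgeSwap_comp_edgeSwap a b ω, ← comp_edgeSwap_comp_edgeSwap a b ω']
    exact congrArg (fun ω : Config m => ω ∘ edgeSwap a b) h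
  calc _ = ∑ ω ∈ cylIn n (reach N (rayVtx a N) n),
        wt (wiredRel m) p q n (ω ∘ edgeSwap a b) :=
        Finset.sum_congr rfl fun ω hω => (wt_comp_edgeSwap a b p q (mem_cylIn.1 hω).1).symm
    _ = ∑ ω ∈ (cylIn n (reach N (rayVtx a N) n)).image fun ω => ω ∘ edgeSwap a b,
        wt (wiredRel m) p q n ω := (Finset.sum_image hinj).symm
    _ ≤ _ := by
        refine Finset.sum_le_sum_of_subset_of_nonneg ?_ fun _ _ _ => wt_nonneg hp0 hp1 hq _ _
        rw [Finset.image_subset_iff]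
        intro ω hω
        obtain ⟨hc, ρ, hρ, hk⟩ := mem_cylIn.1 hω
        refine mem_cylIn.2 ⟨comp_edgeSwap_mem_cyl a b hc, raySwap a b ρ, ?_, fun k h1 h2 => ?_⟩
        · rw [← vtxSwap_rayVtx, hρ, vtxSwap_rayVtx, raySwap_left]
        · rw [Function.comp_apply, edgeSwap_rayEdge, raySwap_raySwap]
          exact hk k h1 h2

theorem sum_biUnion_le_sum {α β : Type*} [DecidableEq α] [DecidableEq β] {f : β → ℝ}
    (hf : ∀ b, 0 ≤ f b) (s : Finset α) (t : α → Finset β) :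
    ∑ b ∈ s.biUnion t, f b ≤ ∑ a ∈ s, ∑ b ∈ t a, f b := by
  induction s using Finset.induction with
  | empty => simp
  | insert a s ha ih =>
    rw [Finset.biUnion_insert, Finset.sum_insert ha]
    have h1 := Finset.sum_union_inter (s₁ := t a) (s₂ := s.biUnion t) (f := f)
    have h2 := Finset.sum_nonneg fun b (_ : b ∈ t a ∩ s.biUnion t) => hf b
    linarith

theorem mass_reach_root_le (a : Ray m) {p q : ℝ} (hp0 : 0 ≤ p) (hp1 : p ≤ 1) (hq : 0 ≤ q)
    (N n : ℕ) : mass (wiredRel m) p q n (reach 0 none n) ≤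
      (ball m N).card * mass (wiredRel m) p q n (reach N (rayVtx a N) n) := by
  calc mass (wiredRel m) p q n (reach 0 none n)
      ≤ ∑ ω ∈ (ball m N).biUnion fun u => cylIn n (reach N u n), wt (wiredRel m) p q n ω := by
        refine Finset.sum_le_sum_of_subset_of_nonneg ?_ fun _ _ _ => wt_nonneg hp0 hp1 hq _ _
        intro ω hω
        obtain ⟨hc, ρ, _, hk⟩ := mem_cylIn.1 hω
        exact Finset.mem_biUnion.2 ⟨rayVtx ρ N, rayVtx_mem_ball.2 le_rfl,
          mem_cylIn.2 ⟨hc, ρ, rfl, fun k _ h => hk k (Nat.zero_le k) h⟩⟩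
    _ ≤ ∑ u ∈ ball m N, ∑ ω ∈ cylIn n (reach N u n), wt (wiredRel m) p q n ω :=
        sum_biUnion_le_sum (wt_nonneg hp0 hp1 hq n) _ _
    _ ≤ ∑ _u ∈ ball m N, mass (wiredRel m) p q n (reach N (rayVtx a N) n) := by
        refine Finset.sum_le_sum fun u _ => ?_
        by_cases hu : ∃ ρ : Ray m, rayVtx ρ N = u
        · obtain ⟨ρ, rfl⟩ := hu
          exact mass_reach_le ρ a hp0 hp1 hq N n
        · have : cylIn n (reach N u n) = ∅ := by
            refine Finset.eq_empty_of_forall_notMem fun ω hω => hu ?_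
            obtain ⟨_, ρ, hρ, _⟩ := mem_cylIn.1 hω
            exact ⟨ρ, hρ⟩
          rw [this, Finset.sum_empty]
          exact mass_nonneg hp0 hp1 hq _ _
    _ = _ := by rw [Finset.sum_const, nsmul_eq_mul]

end Symmetry

section Comparison
open Classical Module
variable {m : ℕ}

/-- The relation of two rays is determined by their first `N` edges. -/
def Determined (S : Ray m → Ray m → Prop) (N : ℕ) : Prop :=
  ∀ ρ ρ', rayVtx ρ N = rayVtx ρ' N → S ρ ρ'

theorem finrank_le_finrank_wired (ρ₀ : Ray m) {S : Ray m → Ray m → Prop} {N n : ℕ}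
    (hS : Determined S N) {ω : Config m} (hω : ω ∈ cyl m n) :
    finrank ℝ (clusterSpace S ω) ≤
      finrank ℝ (clusterSpace (wiredRel m) ω) + (ball m N).card := by
  have := finiteDimensional_clusterSpace ρ₀ S hω
  have := finiteDimensional_clusterSpace ρ₀ (wiredRel m) hω
  rw [← Fintype.card_coe]
  refine finrank_le_add_card _ _ (LinearMap.funLeft ℝ ℝ fun x : {x // x ∈ ball m N} =>
    rayVtx (exists_rayVtx ρ₀ (x : V m)).choose n) fun f hf hL => ⟨hf.1, fun ρ ρ' _ => ?_⟩
  have hzero : ∀ ρ : Ray m, ∀ k ≥ n, f (rayVtx ρ k) = 0 := by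
    intro ρ k hk
    obtain ⟨j, hj⟩ := (exists_rayVtx ρ₀ (rayVtx ρ N)).choose_spec
    obtain rfl := rayVtx_inj hj
    rw [← rayVtx_const_of_mem_cyl hω hf ρ hk, eq_of_related hω hf (hS _ _ hj)]
    exact congrFun hL ⟨rayVtx ρ N, rayVtx_mem_ball.2 le_rfl⟩
  filter_upwards [eventually_ge_atTop n] with k hk
  rw [hzero ρ k hk, hzero ρ' k hk]

theorem mass_univ_le_wired (ρ₀ : Ray m) {S : Ray m → Ray m → Prop} {p q : ℝ} (hp0 : 0 ≤ p)
    (hp1 : p ≤ 1) (hq : 1 ≤ q) {N : ℕ} (hS : Determined S N) (n : ℕ) :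
    mass S p q n Set.univ ≤ q ^ (ball m N).card * mass (wiredRel m) p q n Set.univ := by
  unfold mass
  rw [Finset.mul_sum]
  refine Finset.sum_le_sum fun ω hω => ?_
  have hdim := finrank_le_finrank_wired ρ₀ hS (mem_cylIn.1 hω).1
  rw [wt, wt, mul_left_comm, ← pow_add]
  exact mul_le_mul_of_nonneg_left (pow_le_pow_right₀ hq (by omega))
    (Finset.prod_nonneg fun e _ => edge_factor_nonneg hp0 hp1 _ e)

/-- The configuration that agrees with `σ` on `E` and with `ω` off `E`. -/
def patch (E : Finset (Edge m)) (σ ω : Config m) : Config m :=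
  fun e => if e ∈ E then σ e else ω e

theorem finrank_le_finrank_patch (ρ₀ : Ray m) (S : Ray m → Ray m → Prop) (E : Finset (Edge m))
    (σ : Config m) {n : ℕ} {ω : Config m} (hω : ω ∈ cyl m n) (hσ : patch E σ ω ∈ cyl m n) :
    finrank ℝ (clusterSpace (wiredRel m) ω) ≤
      finrank ℝ (clusterSpace S (patch E σ ω)) + E.card := by
  have := finiteDimensional_clusterSpace ρ₀ (wiredRel m) hω
  have := finiteDimensional_clusterSpace ρ₀ S hσ
  rw [← Fintype.card_coe]
  refine finrank_le_add_card _ _ (LinearMap.funLeft ℝ ℝ (fun e : {e // e ∈ E} => parentV (e : Edge m)) -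
    LinearMap.funLeft ℝ ℝ (fun e : {e // e ∈ E} => childV (e : Edge m))) fun f hf hL =>
    ⟨fun e he => ?_, fun ρ ρ' _ => hf.2 ρ ρ' trivial⟩
  by_cases heE : e ∈ E
  · exact sub_eq_zero.1 (congrFun hL ⟨e, heE⟩)
  · rw [patch, if_neg heE] at he
    exact hf.1 e he

theorem wt_le_wt_patch (ρ₀ : Ray m) (S : Ray m → Ray m → Prop) {p q : ℝ} (hp0 : 0 < p)
    (hp1 : p < 1) (hq : 1 ≤ q) {N n : ℕ} (hNn : N ≤ n) (σ : Config m) {ω : Config m}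
    (hω : ω ∈ cyl m n) (hσ : patch (EdgeFinset (ball m N)) σ ω ∈ cyl m n) :
    wt (wiredRel m) p q n ω ≤
      ((min p (1 - p))⁻¹ * q) ^ (EdgeFinset (ball m N)).card *
        wt S p q n (patch (EdgeFinset (ball m N)) σ ω) := by
  set E := EdgeFinset (ball m N)
  have hδ : 0 < min p (1 - p) := lt_min hp0 (by linarith)
  have hdim := finrank_le_finrank_patch ρ₀ S E σ hω hσ
  have hprod : (∏ e ∈ EdgeFinset (ball m n), if ω e = true then p else 1 - p) ≤
      (min p (1 - p))⁻¹ ^ E.card *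
        ∏ e ∈ EdgeFinset (ball m n), if patch E σ ω e = true then p else 1 - p := by
    rw [← Finset.prod_sdiff (EdgeFinset_ball_mono hNn),
      ← Finset.prod_sdiff (EdgeFinset_ball_mono hNn), mul_left_comm, ← Finset.prod_const,
      ← Finset.prod_mul_distrib]
    refine mul_le_mul (le_of_eq ?_) ?_ (Finset.prod_nonneg fun e _ =>
      edge_factor_nonneg hp0.le hp1.le _ e) (Finset.prod_nonneg fun e _ =>
      edge_factor_nonneg hp0.le hp1.le _ e)
    · refine Finset.prod_congr rfl fun e he => ?_
      rw [patch, if_neg (Finset.mem_sdiff.1 he).2]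
    · refine Finset.prod_le_prod (fun e _ => edge_factor_nonneg hp0.le hp1.le _ e) fun e _ => ?_
      rw [inv_mul_eq_div, le_div_iff₀ hδ]
      have h1 : (if ω e = true then p else 1 - p) ≤ 1 := by split_ifs <;> linarith
      have h2 : min p (1 - p) ≤ if patch E σ ω e = true then p else 1 - p := by
        split_ifs
        · exact min_le_left _ _
        · exact min_le_right _ _
      exact (mul_le_of_le_one_left hδ.le h1).trans h2
  rw [wt, wt, mul_pow, mul_mul_mul_comm, ← pow_add]
  refine mul_le_mul hprod (pow_le_pow_right₀ hq (by omega)) (by positivity) ?_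
  exact mul_nonneg (by positivity) (Finset.prod_nonneg fun e _ =>
    edge_factor_nonneg hp0.le hp1.le _ e)

/-- The event that the states of the edges of `E` are given by `σ`. -/
def agree (E : Finset (Edge m)) (σ : Config m) : Set (Config m) := {ω | ∀ e ∈ E, ω e = σ e}

theorem isClopen_agree (E : Finset (Edge m)) (σ : Config m) : IsClopen (agree E σ) :=
  isClopen_of_local E fun ω ω' h hω e he => by rw [← h e he, hω e he]

/-- Finite energy: forcing the states of finitely many edges costs a bounded factor. -/
theorem mass_wired_le (ρ₀ : Ray m) (S : Ray m → Ray m → Prop) {p q : ℝ} (hp0 : 0 < p)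
    (hp1 : p < 1) (hq : 1 ≤ q) (N : ℕ) (σ : Config m) : ∃ C : ℝ, 0 < C ∧
    ∀ n ≥ N, ∀ R : Set (Config m),
      (∀ ω ∈ R, patch (EdgeFinset (ball m N)) σ ω ∈ R) →
      mass (wiredRel m) p q n R ≤ C * mass S p q n (agree (EdgeFinset (ball m N)) σ ∩ R) := by
  set E := EdgeFinset (ball m N) with hE
  have hδ : 0 < min p (1 - p) := lt_min hp0 (by linarith)
  refine ⟨((min p (1 - p))⁻¹ * q) ^ E.card * (Fintype.card ({e // e ∈ E} → Bool) : ℕ),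
    by positivity, fun n hn R hR => ?_⟩
  have hmaps : ∀ ω ∈ cyl m n, patch E σ ω ∈ cyl m n := fun ω hω => mem_cyl.2 fun e he => by
    rw [patch, if_neg fun he' => he (EdgeFinset_ball_mono hn he')]
    exact mem_cyl.1 hω e he
  unfold mass
  calc ∑ ω ∈ cylIn n R, wt (wiredRel m) p q n ω
      ≤ ∑ ω ∈ cylIn n R, ((min p (1 - p))⁻¹ * q) ^ E.card * wt S p q n (patch E σ ω) :=
        Finset.sum_le_sum fun ω hω => wt_le_wt_patch ρ₀ S hp0 hp1 hq hn σ (mem_cylIn.1 hω).1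
          (hmaps ω (mem_cylIn.1 hω).1)
    _ = ((min p (1 - p))⁻¹ * q) ^ E.card *
          ∑ η ∈ (cylIn n R).image (patch E σ),
            ((cylIn n R).filter fun ω => patch E σ ω = η).card • wt S p q n η := by
        rw [← Finset.mul_sum, Finset.sum_comp]
    _ ≤ ((min p (1 - p))⁻¹ * q) ^ E.card *
          ∑ η ∈ (cylIn n R).image (patch E σ),
            (Fintype.card ({e // e ∈ E} → Bool) : ℝ) * wt S p q n η := by
        refine mul_le_mul_of_nonneg_left (Finset.sum_le_sum fun η _ => ?_) (by positivity)
        rw [nsmul_eq_mul]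
        refine mul_le_mul_of_nonneg_right (Nat.cast_le.2 ?_) (wt_pos hp0 hp1 (by linarith) _ _).le
        refine Finset.card_le_card_of_injOn (fun ω (e : {e // e ∈ E}) => ω e)
          (fun _ _ => Finset.mem_coe.2 (Finset.mem_univ _)) ?_
        intro ω hω ω' hω' h
        have h1 := (Finset.mem_filter.1 (Finset.mem_coe.1 hω)).2
        have h2 := (Finset.mem_filter.1 (Finset.mem_coe.1 hω')).2
        funext e
        by_cases he : e ∈ E
        · exact congrFun h ⟨e, he⟩
        · have := congrFun (h1.trans h2.symm) e
          rwa [patch, patch, if_neg he, if_neg he] at this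
    _ ≤ _ := by
        rw [← Finset.mul_sum, mul_assoc]
        refine mul_le_mul_of_nonneg_left (mul_le_mul_of_nonneg_left ?_ (by positivity))
          (by positivity)
        refine Finset.sum_le_sum_of_subset_of_nonneg ?_ fun _ _ _ =>
          (wt_pos hp0 hp1 (by linarith) _ _).le
        rw [Finset.image_subset_iff]
        intro ω hω
        have hω' := mem_cylIn.1 hω
        exact mem_cylIn.2 ⟨hmaps ω hω'.1, fun e he => by rw [patch, if_pos he], hR ω hω'.2⟩

/-- With probability bounded below, the edges of a ball are in a prescribed state and two given
boundary vertices of this ball are connected to infinity away from the root. -/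
theorem exists_lower_bound {S : Ray m → Ray m → Prop} {p q : ℝ} (hp0 : 0 < p) (hp1 : p < 1)
    (hq : 1 ≤ q) {N : ℕ} (hS : Determined S N) {ψ : Measure (Config m)} [IsProbabilityMeasure ψ]
    (hψ : WeakLim (fun Λ => rcFin (wiredRel m) p q Λ (oneCfg m)) ψ)
    (hθ : 0 < ψ {ω | ∃ ρ : Ray m, OpenRay ω ρ}) (a b : Ray m) (σ : Config m) :
    ∃ c : ℝ, 0 < c ∧ ∀ n ≥ N, c * mass S p q n Set.univ ≤
      mass S p q n (agree (EdgeFinset (ball m N)) σ ∩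
        (reach N (rayVtx a N) n ∩ reach N (rayVtx b N) n)) := by
  obtain ⟨C, hC, hle⟩ := mass_wired_le a S hp0 hp1 hq N σ
  set θ := ψ.real {ω | ∃ ρ : Ray m, OpenRay ω ρ}
  have hθ' : 0 < θ := ENNReal.toReal_pos hθ.ne' (measure_ne_top _ _)
  have hB : (0 : ℝ) < (ball m N).card :=
    Nat.cast_pos.2 (Finset.card_pos.2 ⟨rayVtx a N, rayVtx_mem_ball.2 le_rfl⟩)
  refine ⟨(θ / (ball m N).card) ^ 2 / (C * q ^ (ball m N).card), by positivity, fun n hn => ?_⟩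
  have hq0 : 0 ≤ q := by linarith
  have hroot : ∀ a : Ray m, θ / (ball m N).card * mass (wiredRel m) p q n Set.univ ≤
      mass (wiredRel m) p q n (reach N (rayVtx a N) n) := by
    intro a
    have h1 := real_reach_mul_le_mass a hp0 hp1 hq hψ n
    have h2 := mass_reach_root_le a hp0.le hp1.le hq0 N n
    have h3 : θ ≤ ψ.real (reach 0 none n) :=
      measureReal_mono fun ω ⟨ρ, hρ⟩ => ⟨ρ, rfl, fun k _ _ => hρ k⟩
    rw [div_mul_eq_mul_div, div_le_iff₀ hB, mul_comm _ ((ball m N).card : ℝ)]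
    exact (mul_le_mul_of_nonneg_right h3 (mass_nonneg hp0.le hp1.le hq0 _ _)).trans (h1.trans h2)
  have hZ : 0 < mass (wiredRel m) p q n Set.univ := mass_univ_pos hp0 hp1 (by linarith) n
  have hfkg := mass_fkg a (wiredRel m) hp0.le hp1.le hq n
    (increasingEvent_reach N (rayVtx a N) n) (increasingEvent_reach N (rayVtx b N) n)
  have hR : (θ / (ball m N).card) ^ 2 * mass (wiredRel m) p q n Set.univ ≤
      mass (wiredRel m) p q n (reach N (rayVtx a N) n ∩ reach N (rayVtx b N) n) := by
    refine le_of_mul_le_mul_right (le_trans (le_of_eq ?_) ((mul_le_mul (hroot a) (hroot b)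
      (by positivity) (mass_nonneg hp0.le hp1.le hq0 _ _)).trans hfkg)) hZ
    ring
  have hpatch : ∀ a : Ray m, ∀ ω ∈ reach N (rayVtx a N) n,
      patch (EdgeFinset (ball m N)) σ ω ∈ reach N (rayVtx a N) n := by
    rintro a ω ⟨ρ, hρ, hk⟩
    refine ⟨ρ, hρ, fun k h1 h2 => ?_⟩
    rw [patch, if_neg]
    · exact hk k h1 h2
    · rw [mem_EdgeFinset, rayEdge_mem_ELam_ball]
      omega
  have h4 := hle n hn (reach N (rayVtx a N) n ∩ reach N (rayVtx b N) n)
    fun ω hω => ⟨hpatch a ω hω.1, hpatch b ω hω.2⟩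
  have h5 := mass_univ_le_wired a hp0.le hp1.le hq hS n
  rw [div_mul_eq_mul_div, div_le_iff₀ (by positivity)]
  calc (θ / (ball m N).card) ^ 2 * mass S p q n Set.univ
      ≤ (θ / (ball m N).card) ^ 2 *
        (q ^ (ball m N).card * mass (wiredRel m) p q n Set.univ) :=
        mul_le_mul_of_nonneg_left h5 (by positivity)
    _ = q ^ (ball m N).card *
        ((θ / (ball m N).card) ^ 2 * mass (wiredRel m) p q n Set.univ) := by ring
    _ ≤ q ^ (ball m N).card * (C * mass S p q n (agree (EdgeFinset (ball m N)) σ ∩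
        (reach N (rayVtx a N) n ∩ reach N (rayVtx b N) n))) :=
        mul_le_mul_of_nonneg_left (hR.trans h4) (by positivity)
    _ = _ := by ring

end Comparison

section Distinguish
open Classical Module
variable {m : ℕ}

theorem Determined.mono {S : Ray m → Ray m → Prop} {N N' : ℕ} (hS : Determined S N)
    (h : N ≤ N') : Determined S N' :=
  fun ρ ρ' hρ => hS ρ ρ' (rayVtx_eq_of_le hρ h)

theorem isOpen_setOf_rayVtx_eq (ρ : Ray m) (N : ℕ) :
    IsOpen {ρ' : Ray m | rayVtx ρ N = rayVtx ρ' N} := by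
  cases N with
  | zero => simp [rayVtx]
  | succ N =>
    simp only [rayVtx_succ_eq_iff, Set.ofPred_and, Set.ofPred_forall]
    refine IsOpen.inter ?_ ?_
    · exact (isOpen_discrete {a | ρ.1 = a}).preimage continuous_fst
    · refine Set.Finite.isOpen_biInter (Set.finite_Iio N) fun j _ => ?_
      exact (isOpen_discrete {a | ρ.2 j = a}).preimage ((continuous_apply j).comp continuous_snd)

theorem exists_rayVtx_eq_subset {U : Set (Ray m)} (hU : IsOpen U) {ρ : Ray m} (hρ : ρ ∈ U) :
    ∃ N, ∀ ρ', rayVtx ρ N = rayVtx ρ' N → ρ' ∈ U := by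
  obtain ⟨A, B, hA, hB, h1, h2, hAB⟩ := isOpen_prod_iff.1 hU ρ.1 ρ.2 hρ
  obtain ⟨I, u, hu, hIB⟩ := isOpen_pi_iff.1 hB ρ.2 h2
  refine ⟨I.sup id + 1 + 1, fun ρ' h => hAB ⟨?_, hIB fun j hj => ?_⟩⟩
  · rw [← ((rayVtx_succ_eq_iff _ _ _).1 h).1]
    exact h1
  · rw [← ((rayVtx_succ_eq_iff _ _ _).1 h).2 j
      (Nat.lt_succ_of_le (Finset.le_sup (f := id) hj))]
    exact (hu j hj).2

theorem exists_determined {S : Ray m → Ray m → Prop} (hS : Equivalence S)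
    (ho : IsOpen {x : Ray m × Ray m | S x.1 x.2}) : ∃ N, Determined S N := by
  let G : ℕ → Set (Ray m) := fun N => {ρ | ∀ ρ', rayVtx ρ N = rayVtx ρ' N → S ρ ρ'}
  have hG : ∀ N, IsOpen (G N) := by
    intro N
    refine isOpen_iff_forall_mem_open.2 fun ρ hρ =>
      ⟨{ρ' | rayVtx ρ N = rayVtx ρ' N}, fun ρ' h ρ'' h' => ?_, isOpen_setOf_rayVtx_eq ρ N, rfl⟩
    exact hS.trans (hS.symm (hρ ρ' h)) (hρ ρ'' (Eq.trans h h'))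
  have hcover : (Set.univ : Set (Ray m)) ⊆ ⋃ N, G N := by
    intro ρ _
    obtain ⟨N, hN⟩ := exists_rayVtx_eq_subset
      (ho.preimage (Continuous.prodMk_right ρ) : IsOpen {ρ' | S ρ ρ'}) (hS.refl ρ)
    exact Set.mem_iUnion.2 ⟨N, hN⟩
  have hmono : Monotone G := fun N N' h ρ hρ ρ' h' => hρ ρ' (rayVtx_eq_of_le h' h)
  obtain ⟨N, hN⟩ := isCompact_univ.elim_directed_cover G hG hcover hmono.directed_le
  exact ⟨N, fun ρ ρ' h => hN (Set.mem_univ ρ) ρ' h⟩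

theorem pos_of_percolates (ρ₀ : Ray m) {p q : ℝ} (hp0 : 0 ≤ p) (hp1 : p ≤ 1) (hq : 0 ≤ q)
    {ψ : Measure (Config m)} [IsProbabilityMeasure ψ]
    (hψ : WeakLim (fun Λ => rcFin (wiredRel m) p q Λ (oneCfg m)) ψ)
    (hθ : 0 < ψ {ω | ∃ ρ : Ray m, OpenRay ω ρ}) : 0 < p := by
  refine hp0.lt_of_ne fun h => ?_
  have hlim := hψ.tendsto_mass ρ₀ hp0 hp1 hq (isClopen_reach 0 none 1)
  have hzero : ∀ n ≥ 1, mass (wiredRel m) p q n (reach 0 none 1) = 0 := by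
    intro n hn
    refine Finset.sum_eq_zero fun ω hω => ?_
    obtain ⟨ρ, _, hρ⟩ := (mem_cylIn.1 hω).2
    rw [wt, Finset.prod_eq_zero (i := rayEdge ρ 0), zero_mul]
    · rw [mem_EdgeFinset, rayEdge_mem_ELam_ball]
      exact hn
    · rw [if_pos (hρ 0 le_rfl one_pos), h]
  have h0 : ψ.real (reach 0 none 1) = 0 := by
    refine tendsto_nhds_unique hlim (tendsto_const_nhds.congr' ?_)
    filter_upwards [eventually_ge_atTop 1] with n hn
    rw [hzero n hn, zero_div]
  have h1 : ψ.real {ω | ∃ ρ : Ray m, OpenRay ω ρ} ≤ ψ.real (reach 0 none 1) :=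
    measureReal_mono fun ω ⟨ρ, hρ⟩ => ⟨ρ, rfl, fun k _ _ => hρ k⟩
  have h2 : 0 < ψ.real {ω | ∃ ρ : Ray m, OpenRay ω ρ} :=
    ENNReal.toReal_pos hθ.ne' (measure_ne_top _ _)
  linarith

theorem update_mem_cyl {n : ℕ} {ω : Config m} (hω : ω ∈ cyl m n) (e : Edge m) :
    Function.update ω e true ∈ cyl m n :=
  mem_cyl_of_le hω fun e' h => by
    by_cases he : e' = e
    · subst he; simp
    · simpa [he] using h

theorem wt_update (S : Ray m → Ray m → Prop) {p : ℝ} (q : ℝ) (hp0 : 0 ≤ p) (hp1 : p ≤ 1) {n : ℕ}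
    {ω : Config m} {e : Edge m} (he : e ∈ EdgeFinset (ball m n)) (hωe : ω e = false) :
    ∃ P : ℝ, 0 ≤ P ∧ wt S p q n ω = (1 - p) * P * q ^ finrank ℝ (clusterSpace S ω) ∧
      wt S p q n (Function.update ω e true) =
        p * P * q ^ finrank ℝ (clusterSpace S (Function.update ω e true)) := by
  refine ⟨∏ e' ∈ (EdgeFinset (ball m n)).erase e, if ω e' = true then p else 1 - p,
    Finset.prod_nonneg fun e' _ => edge_factor_nonneg hp0 hp1 _ e', ?_, ?_⟩
  · rw [wt, ← Finset.mul_prod_erase _ _ he, hωe]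
    simp
  · rw [wt, ← Finset.mul_prod_erase _ _ he, Function.update_self, if_pos rfl]
    congr 2
    refine Finset.prod_congr rfl fun e' he' => ?_
    rw [Function.update_of_ne (Finset.ne_of_mem_erase he')]

theorem clusterSpace_update_le (S : Ray m → Ray m → Prop) (ω : Config m) (e : Edge m) :
    clusterSpace S (Function.update ω e true) ≤ clusterSpace S ω := by
  refine fun f hf => ⟨fun e' he' => hf.1 e' ?_, hf.2⟩
  by_cases h : e' = e
  · subst h; simp
  · simpa [h] using he'

theorem mem_clusterSpace_update {S : Ray m → Ray m → Prop} {ω : Config m} {e : Edge m}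
    {f : V m → ℝ} (hf : f ∈ clusterSpace S ω) (he : f (parentV e) = f (childV e)) :
    f ∈ clusterSpace S (Function.update ω e true) := by
  refine ⟨fun e' he' => ?_, hf.2⟩
  by_cases h : e' = e
  · rw [h, he]
  · rw [Function.update_of_ne h] at he'
    exact hf.1 e' he'

theorem finrank_le_finrank_update_add_one (ρ₀ : Ray m) (S : Ray m → Ray m → Prop) {n : ℕ}
    {ω : Config m} (hω : ω ∈ cyl m n) (e : Edge m) :
    finrank ℝ (clusterSpace S ω) ≤
      finrank ℝ (clusterSpace S (Function.update ω e true)) + 1 := by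
  have := finiteDimensional_clusterSpace ρ₀ S hω
  have := finiteDimensional_clusterSpace ρ₀ S (update_mem_cyl hω e)
  refine finrank_le_add_card (ι := Unit) _ _ (LinearMap.funLeft ℝ ℝ (fun _ => parentV e) -
    LinearMap.funLeft ℝ ℝ (fun _ => childV e)) fun f hf hL => ?_
  exact mem_clusterSpace_update hf (sub_eq_zero.1 (congrFun hL ()))

/-- Opening the edge at level `M` of the ray `a` does not change the number of clusters if the
endpoints are already connected through infinity. -/
theorem finrank_update_of_related {S : Ray m → Ray m → Prop} (hequiv : Equivalence S) {M n : ℕ}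
    (hS : Determined S (M + 1)) (hn : M + 1 ≤ n) {a b : Ray m} (hab : S a b) {ω : Config m}
    (hω : ω ∈ cyl m n) (ha : ω ∈ reach (M + 1) (rayVtx a (M + 1)) n)
    (hb : ω ∈ reach (M + 1) (rayVtx b (M + 1)) n) (hao : ∀ k < M, ω (rayEdge a k) = true)
    (hbo : ∀ k < M + 1, ω (rayEdge b k) = true) :
    finrank ℝ (clusterSpace S (Function.update ω (rayEdge a M) true)) =
      finrank ℝ (clusterSpace S ω) := by
  suffices clusterSpace S (Function.update ω (rayEdge a M) true) = clusterSpace S ω by rw [this]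
  refine le_antisymm (clusterSpace_update_le _ _ _) fun f hf => mem_clusterSpace_update hf ?_
  rw [parentV_rayEdge, childV_rayEdge]
  obtain ⟨ρ, hρ, hρo⟩ := ha
  obtain ⟨τ, hτ, hτo⟩ := hb
  have hrel : S ρ τ := hequiv.trans (hS _ _ hρ) (hequiv.trans hab (hS _ _ hτ.symm))
  rw [← rayVtx_const_of_open hf (Nat.zero_le M) fun i _ hi => hao i hi, ← hρ,
    rayVtx_const_of_open hf hn hρo, eq_of_related hω hf hrel, ← rayVtx_const_of_open hf hn hτo, hτ,
    ← rayVtx_const_of_open hf (Nat.zero_le (M + 1)) fun i _ hi => hbo i hi]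
  rfl

/-- Opening the edge at level `M` of the ray `a` decreases the number of clusters if the only
route between its endpoints would have to connect the unrelated rays `a` and `b`. -/
theorem finrank_update_of_not_related {S : Ray m → Ray m → Prop} (hequiv : Equivalence S)
    {M n : ℕ} (hS : Determined S (M + 1)) {a b : Ray m} (hab : ¬ S a b) {ω : Config m}
    (hω : ω ∈ cyl m n) (hopen : ∀ e ∈ EdgeFinset (ball m (M + 1)), ω e = true →
      (∃ k < M, e = rayEdge a k) ∨ ∃ k < M + 1, e = rayEdge b k) :
    finrank ℝ (clusterSpace S ω) =
      finrank ℝ (clusterSpace S (Function.update ω (rayEdge a M) true)) + 1 := by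
  refine le_antisymm (finrank_le_finrank_update_add_one a S hω _) (Nat.succ_le_of_lt ?_)
  have := finiteDimensional_clusterSpace a S hω
  refine Submodule.finrank_lt_finrank_of_lt
    (lt_of_le_of_ne (clusterSpace_update_le _ _ _) fun heq => ?_)
  let X : Set (V m) := {x | ∃ ρ k, M + 1 ≤ k ∧ rayVtx ρ k = x ∧ S ρ a}
  have hX : ∀ (ρ : Ray m) (k : ℕ), rayVtx ρ k ∈ X ↔ M + 1 ≤ k ∧ S ρ a := by
    refine fun ρ k => ⟨?_, fun h => ⟨ρ, k, h.1, rfl, h.2⟩⟩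
    rintro ⟨τ, j, hj, h, hτ⟩
    obtain rfl := rayVtx_inj h
    exact ⟨hj, hequiv.trans (hS _ _ (rayVtx_eq_of_le h hj).symm) hτ⟩
  have hf : X.indicator (1 : V m → ℝ) ∈ clusterSpace S ω := by
    refine ⟨fun e he => ?_, fun ρ ρ' h => Eventually.of_forall fun k => ?_⟩
    · suffices parentV e ∈ X ↔ childV e ∈ X by
        by_cases hc : childV e ∈ X
        · rw [Set.indicator_of_mem hc, Set.indicator_of_mem (this.2 hc)]; rfl
        · rw [Set.indicator_of_notMem hc, Set.indicator_of_notMem (mt this.1 hc)]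
      obtain ⟨ρ, k, rfl⟩ := exists_rayEdge (a.2 0) e
      by_cases hk : k < M + 1
      · rcases hopen _ (by rwa [mem_EdgeFinset, rayEdge_mem_ELam_ball]) he with
          ⟨j, hj, h⟩ | ⟨j, hj, h⟩
        · rw [h, parentV_rayEdge, childV_rayEdge, hX, hX]
          omega
        · rw [h, parentV_rayEdge, childV_rayEdge, hX, hX]
          exact iff_of_false (fun h => hab (hequiv.symm h.2)) fun h => hab (hequiv.symm h.2)
      · rw [parentV_rayEdge, childV_rayEdge, hX, hX]
        exact and_congr_left fun _ => by omega
    · have : rayVtx ρ k ∈ X ↔ rayVtx ρ' k ∈ X := by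
        rw [hX, hX]
        exact and_congr_right fun _ =>
          ⟨fun h' => hequiv.trans (hequiv.symm h) h', fun h' => hequiv.trans h h'⟩
      by_cases hc : rayVtx ρ k ∈ X
      · rw [Set.indicator_of_mem hc, Set.indicator_of_mem (this.1 hc)]; rfl
      · rw [Set.indicator_of_notMem hc, Set.indicator_of_notMem (mt this.2 hc)]
  rw [← heq] at hf
  have h := hf.1 (rayEdge a M) (Function.update_self ..)
  rw [parentV_rayEdge, childV_rayEdge, Set.indicator_of_notMem (by rw [hX]; omega),
    Set.indicator_of_mem ((hX _ _).2 ⟨le_rfl, hequiv.refl a⟩)] at h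
  exact zero_ne_one h

theorem mass_agree_eq_sum_update (S : Ray m → Ray m → Prop) (p q : ℝ) {N n : ℕ} (hn : N ≤ n)
    {σ : Config m} {e : Edge m} (he : e ∈ EdgeFinset (ball m N)) (hσ : σ e = true) :
    mass S p q n (agree (EdgeFinset (ball m N)) σ) =
      ∑ ω ∈ cylIn n (agree (EdgeFinset (ball m N)) (Function.update σ e false)),
        wt S p q n (Function.update ω e true) := by
  refine Finset.sum_bij' (fun ω _ => Function.update ω e false)
    (fun ω _ => Function.update ω e true) ?_ ?_ ?_ ?_ ?_
  · intro ω hω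
    obtain ⟨h1, h2⟩ := mem_cylIn.1 hω
    refine mem_cylIn.2 ⟨mem_cyl.2 fun e' he' => ?_, fun e' he' => ?_⟩
    · rw [Function.update_of_ne]
      · exact mem_cyl.1 h1 e' he'
      · rintro rfl
        exact he' (EdgeFinset_ball_mono hn he)
    · by_cases h : e' = e
      · subst h; simp
      · rw [Function.update_of_ne h, Function.update_of_ne h, h2 e' he']
  · intro ω hω
    obtain ⟨h1, h2⟩ := mem_cylIn.1 hω
    refine mem_cylIn.2 ⟨update_mem_cyl h1 e, fun e' he' => ?_⟩
    by_cases h : e' = e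
    · subst h; simp [hσ]
    · rw [Function.update_of_ne h, h2 e' he', Function.update_of_ne h]
  · intro ω hω
    have := (mem_cylIn.1 hω).2 e he
    simp [← hσ, ← this]
  · intro ω hω
    have := (mem_cylIn.1 hω).2 e he
    rw [Function.update_self] at this
    simp [← this]
  · intro ω hω
    have := (mem_cylIn.1 hω).2 e he
    simp [← hσ, ← this]

/-- The configuration whose open edges are the first `N` edges of the rays `a` and `b`. -/
noncomputable def twoPaths (a b : Ray m) (N : ℕ) : Config m :=
  fun e => decide (∃ k < N, e = rayEdge a k ∨ e = rayEdge b k)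

theorem twoPaths_left (a b : Ray m) {N k : ℕ} (hk : k < N) :
    twoPaths a b N (rayEdge a k) = true :=
  decide_eq_true ⟨k, hk, Or.inl rfl⟩

theorem twoPaths_right (a b : Ray m) {N k : ℕ} (hk : k < N) :
    twoPaths a b N (rayEdge b k) = true :=
  decide_eq_true ⟨k, hk, Or.inr rfl⟩

theorem real_agree_of_not_related {S : Ray m → Ray m → Prop} (hequiv : Equivalence S)
    {p q : ℝ} (hp0 : 0 < p) (hp1 : p < 1) (hq : 1 < q) {M : ℕ} (hS : Determined S (M + 1))
    {a b : Ray m} (hab : ¬ S a b) {ψ : Measure (Config m)} [IsProbabilityMeasure ψ]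
    (hψ : WeakLim (fun Λ => rcFin S p q Λ (oneCfg m)) ψ) :
    (1 - p) * q * ψ.real (agree (EdgeFinset (ball m (M + 1))) (twoPaths a b (M + 1))) =
      p * ψ.real (agree (EdgeFinset (ball m (M + 1)))
        (Function.update (twoPaths a b (M + 1)) (rayEdge a M) false)) := by
  have he : rayEdge a M ∈ EdgeFinset (ball m (M + 1)) := by
    rw [mem_EdgeFinset, rayEdge_mem_ELam_ball]
    omega
  refine tendsto_nhds_unique
    ((hψ.tendsto_mass a hp0.le hp1.le (by linarith) (isClopen_agree _ _)).const_mul _)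
    (Tendsto.congr' ?_
      ((hψ.tendsto_mass a hp0.le hp1.le (by linarith) (isClopen_agree _ _)).const_mul _))
  filter_upwards [eventually_ge_atTop (M + 1)] with n hn
  rw [mul_div_assoc', mul_div_assoc']
  congr 1
  rw [mass_agree_eq_sum_update S p q hn he (twoPaths_left a b M.lt_succ_self), mass,
    Finset.mul_sum, Finset.mul_sum]
  refine Finset.sum_congr rfl fun ω hω => ?_
  obtain ⟨h1, h2⟩ := mem_cylIn.1 hω
  have hωe := h2 _ he
  rw [Function.update_self] at hωe
  obtain ⟨P, -, hP0, hP1⟩ := wt_update S q hp0.le hp1.le (EdgeFinset_ball_mono hn he) hωe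
  rw [hP0, hP1, finrank_update_of_not_related hequiv hS hab h1]
  · ring
  · intro e' he' ho
    have hne : e' ≠ rayEdge a M := by
      rintro rfl
      rw [hωe] at ho
      exact Bool.false_ne_true ho
    rw [h2 e' he', Function.update_of_ne hne, twoPaths, decide_eq_true_eq] at ho
    obtain ⟨k, hk, rfl | rfl⟩ := ho
    · refine Or.inl ⟨k, lt_of_le_of_ne (Nat.le_of_lt_succ hk) ?_, rfl⟩
      rintro rfl
      exact hne rfl
    · exact Or.inr ⟨k, hk, rfl⟩

theorem lt_real_agree_of_related {S : Ray m → Ray m → Prop} (hequiv : Equivalence S)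
    {p q : ℝ} (hp0 : 0 < p) (hp1 : p < 1) (hq : 1 < q) {M : ℕ} (hS : Determined S (M + 1))
    {a b : Ray m} (hab : S a b) (hne : rayVtx a (M + 1) ≠ rayVtx b (M + 1))
    {ψw ψ : Measure (Config m)} [IsProbabilityMeasure ψw] [IsProbabilityMeasure ψ]
    (hψw : WeakLim (fun Λ => rcFin (wiredRel m) p q Λ (oneCfg m)) ψw)
    (hθ : 0 < ψw {ω | ∃ ρ : Ray m, OpenRay ω ρ})
    (hψ : WeakLim (fun Λ => rcFin S p q Λ (oneCfg m)) ψ) :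
    p * ψ.real (agree (EdgeFinset (ball m (M + 1)))
        (Function.update (twoPaths a b (M + 1)) (rayEdge a M) false)) <
      (1 - p) * q * ψ.real (agree (EdgeFinset (ball m (M + 1))) (twoPaths a b (M + 1))) := by
  have he : rayEdge a M ∈ EdgeFinset (ball m (M + 1)) := by
    rw [mem_EdgeFinset, rayEdge_mem_ELam_ball]
    omega
  obtain ⟨c, hc, hle⟩ := exists_lower_bound hp0 hp1 hq.le hS hψw hθ a b
    (Function.update (twoPaths a b (M + 1)) (rayEdge a M) false)
  set F := agree (EdgeFinset (ball m (M + 1))) (twoPaths a b (M + 1)) with hF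
  set G := agree (EdgeFinset (ball m (M + 1)))
    (Function.update (twoPaths a b (M + 1)) (rayEdge a M) false) with hG
  have hq0 : 0 ≤ q := by linarith
  have hpos : 0 < (q - 1) * p * c := by
    have := sub_pos.2 hq
    positivity
  suffices p * ψ.real G + (q - 1) * p * c ≤ (1 - p) * q * ψ.real F by linarith
  refine le_of_tendsto_of_tendsto
    (((hψ.tendsto_mass a hp0.le hp1.le hq0 (isClopen_agree _ _)).const_mul p).add_const _)
    ((hψ.tendsto_mass a hp0.le hp1.le hq0 (isClopen_agree _ _)).const_mul _) ?_
  filter_upwards [eventually_ge_atTop (M + 1)] with n hn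
  have hZ : 0 < mass S p q n Set.univ := mass_univ_pos hp0 hp1 (by linarith) n
  rw [mul_div_assoc', mul_div_assoc', div_add' _ _ _ hZ.ne']
  refine div_le_div_of_nonneg_right ?_ hZ.le
  set R := reach (M + 1) (rayVtx a (M + 1)) n ∩ reach (M + 1) (rayVtx b (M + 1)) n with hR
  have hstep : p * mass S p q n G + (q - 1) * p * mass S p q n (G ∩ R) ≤
      (1 - p) * q * mass S p q n F := by
    have hGR : mass S p q n (G ∩ R) = ∑ ω ∈ cylIn n G, if ω ∈ R then wt S p q n ω else 0 := by
      rw [← Finset.sum_filter, mass]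
      refine Finset.sum_congr ?_ fun _ _ => rfl
      ext ω
      simp [mem_cylIn, and_assoc]
    rw [hGR, hF, mass_agree_eq_sum_update S p q hn he (twoPaths_left a b M.lt_succ_self), ← hG,
      mass, Finset.mul_sum, Finset.mul_sum, Finset.mul_sum, ← Finset.sum_add_distrib]
    refine Finset.sum_le_sum fun ω hω => ?_
    obtain ⟨h1, h2⟩ := mem_cylIn.1 hω
    have hωe := h2 _ he
    rw [Function.update_self] at hωe
    obtain ⟨P, hP, hP0, hP1⟩ := wt_update S q hp0.le hp1.le (EdgeFinset_ball_mono hn he) hωe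
    rw [hP0, hP1]
    have hq1 : 0 ≤ 1 - p := by linarith
    split_ifs with hωR
    · rw [finrank_update_of_related hequiv hS hn hab h1 hωR.1 hωR.2]
      · exact le_of_eq (by ring)
      · intro k hk
        rw [h2 _ (by rw [mem_EdgeFinset, rayEdge_mem_ELam_ball]; omega), Function.update_of_ne]
        · exact twoPaths_left a b (by omega)
        · intro h
          exact hk.ne (rayEdge_inj h)
      · intro k hk
        rw [h2 _ (by rw [mem_EdgeFinset, rayEdge_mem_ELam_ball]; omega), Function.update_of_ne]
        · exact twoPaths_right a b hk
        · intro h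
          obtain rfl := rayEdge_inj h
          exact hne (congrArg some h.symm)
    · have hk := pow_le_pow_right₀ hq.le (finrank_le_finrank_update_add_one a S h1 (rayEdge a M))
      rw [mul_zero, add_zero]
      calc _ = (1 - p) * p * P * q ^ finrank ℝ (clusterSpace S ω) := by ring
        _ ≤ (1 - p) * p * P *
            q ^ (finrank ℝ (clusterSpace S (Function.update ω (rayEdge a M) true)) + 1) := by
          gcongr
        _ = _ := by ring
  have := mul_le_mul_of_nonneg_left (hle n hn)
    (mul_nonneg (sub_nonneg.2 hq.le) hp0.le)
  linarith

theorem ne_of_related_of_not_related {S S' : Ray m → Ray m → Prop}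
    (hequiv : Equivalence S) (hopen : IsOpen {x : Ray m × Ray m | S x.1 x.2})
    (hequiv' : Equivalence S') (hopen' : IsOpen {x : Ray m × Ray m | S' x.1 x.2})
    {a b : Ray m} (hab : S a b) (hab' : ¬ S' a b)
    {p q : ℝ} (hp0 : 0 < p) (hp1 : p < 1) (hq : 1 < q)
    {ψw ψ ψ' : Measure (Config m)} [IsProbabilityMeasure ψw] [IsProbabilityMeasure ψ]
    [IsProbabilityMeasure ψ']
    (hψw : WeakLim (fun Λ => rcFin (wiredRel m) p q Λ (oneCfg m)) ψw)
    (hθ : 0 < ψw {ω | ∃ ρ : Ray m, OpenRay ω ρ})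
    (hψ : WeakLim (fun Λ => rcFin S p q Λ (oneCfg m)) ψ)
    (hψ' : WeakLim (fun Λ => rcFin S' p q Λ (oneCfg m)) ψ') : ψ ≠ ψ' := by
  rintro rfl
  obtain ⟨N, hN⟩ := exists_determined hequiv hopen
  obtain ⟨N', hN'⟩ := exists_determined hequiv' hopen'
  have hS : Determined S (max N N' + 1) := hN.mono (by omega)
  have hS' : Determined S' (max N N' + 1) := hN'.mono (by omega)
  exact (lt_real_agree_of_related hequiv hp0 hp1 hq hS hab (fun h => hab' (hS' _ _ h))
    hψw hθ hψ).ne' (real_agree_of_not_related hequiv' hp0 hp1 hq hS' hab' hψ')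

end Distinguish

/-- Let `q > 1` and `p ∈ [0,1]`, `p ≠ 1`, with `θ¹(p,q) > 0`. Then for
distinct open equivalence relations `∼` and `∼'` on the rays of `T'_m`, the weak-limit
measures `φ^{1,∼}_{p,q}` and `φ^{1,∼'}_{p,q}` are distinct. -/
theorem distinct_open_relations_distinct_measures (m : ℕ) (hm : 2 ≤ m)
    (S S' : Ray m → Ray m → Prop)
    (hequiv : Equivalence S) (hopen : IsOpen {x : Ray m × Ray m | S x.1 x.2})
    (hequiv' : Equivalence S') (hopen' : IsOpen {x : Ray m × Ray m | S' x.1 x.2})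
    (hne : S ≠ S')
    (p q : ℝ) (hp0 : 0 ≤ p) (hp1 : p ≤ 1) (hp : p ≠ 1) (hq : 1 < q)
    (ψw : Measure (Config m)) (hψwprob : IsProbabilityMeasure ψw)
    (hψw : WeakLim (fun Λ => rcFin (wiredRel m) p q Λ (oneCfg m)) ψw)
    (htheta : 0 < ψw {ω | ∃ ρ : Ray m, OpenRay ω ρ})
    (ψ : Measure (Config m)) (hψprob : IsProbabilityMeasure ψ)
    (hψ : WeakLim (fun Λ => rcFin S p q Λ (oneCfg m)) ψ)
    (ψ' : Measure (Config m)) (hψprob' : IsProbabilityMeasure ψ')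
    (hψ' : WeakLim (fun Λ => rcFin S' p q Λ (oneCfg m)) ψ') :
    ψ ≠ ψ' := by
  obtain ⟨a, b, hab⟩ : ∃ a b, ¬ (S a b ↔ S' a b) := by
    by_contra! h
    exact hne (funext fun a => funext fun b => propext (h a b))
  have hp0 : 0 < p := pos_of_percolates a hp0 hp1 (by linarith) hψw htheta
  have hp1 : p < 1 := hp1.lt_of_ne hp
  by_cases h : S a b
  · exact ne_of_related_of_not_related hequiv hopen hequiv' hopen' h
      (fun h' => hab ⟨fun _ => h', fun _ => h⟩) hp0 hp1 hq hψw htheta hψ hψ'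
  · have h' : S' a b := by tauto
    exact (ne_of_related_of_not_related hequiv' hopen' hequiv hopen h' h
      hp0 hp1 hq hψw htheta hψ' hψ).symm

end RCTree
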